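/- arXiv:2509.22109 — 2 statements merged into one kernel-verified Lean document; each statement's English description precedes it below -/
import Mathlib

section
/- Let c ∈ 𝕋 with c ≠ 0 and let μ be a g-measure for g^c that is non-atomic and satisfies μ(⟨ω⟩) > 0 for every finite binary word ω. Define p(t) = P̄_top(tψ^c) ∈ ℝ ∪ {+∞}, its Legendre transform p*(a) = sup_{t∈ℝ} (t·a − p(t)), and α̲_c = inf{a ∈ ℝ : p*(a) < ∞} ∈ ℝ ∪ {−∞}. Then for every α ∈ ℝ with α ≠ −α̲_c/log 2, the Hausdorff dimension of {x ∈ 𝕋 : d_μ(x) = α} equals the Hausdorff dimension of {x ∈ 𝕋 : lim_{n→∞} ψ^c_n(x)/n = −α·log 2}. -/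
open MeasureTheory Filter Topology Set
open scoped ENNReal

noncomputable section

namespace GTM

abbrev Torus := AddCircle (1 : ℝ)

instance : Fact ((0:ℝ) < 1) := ⟨one_pos⟩

/-- The doubling map on the torus. -/
def dbl (x : Torus) : Torus := x + x

/-- The function `x ↦ |cos (π x)|` lifted to the torus. -/
def absCos : Torus → ℝ :=
  Function.Periodic.lift (f := fun x : ℝ => |Real.cos (Real.pi * x)|)
    (by
      intro x
      simp [mul_add, mul_one, Real.cos_add_pi, abs_neg])

/-- The potential `ψ^c(x) = 2 log |cos (π (x - c))|`, with value `⊥ = -∞` at the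
singularity `c + 1/2`. -/
def psi (c : Torus) (x : Torus) : EReal :=
  if absCos (x - c) = 0 then ⊥ else ((2 * Real.log (absCos (x - c)) : ℝ) : EReal)

/-- The Birkhoff sums `ψ^c_n` of the potential `ψ^c` under the doubling map. -/
def psiSum (c : Torus) (n : ℕ) (x : Torus) : EReal :=
  ∑ k ∈ Finset.range n, psi c (dbl^[k] x)

/-- The left endpoint of the dyadic cylinder interval of a binary word. -/
def wordVal (n : ℕ) (ω : Fin n → Bool) : ℝ :=
  ∑ i : Fin n, (if ω i then (1 : ℝ) else 0) / 2 ^ ((i : ℕ) + 1)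

/-- The closed dyadic interval `⟨ω⟩ ⊆ 𝕋` associated to a binary word `ω`. -/
def cyl (n : ℕ) (ω : Fin n → Bool) : Set Torus :=
  (fun x : ℝ => (x : Torus)) '' Set.Icc (wordVal n ω) (wordVal n ω + 1 / 2 ^ n)

/-- The exponential function on extended reals, `exp ⊥ = 0`, `exp ⊤ = ∞`. -/
def eexp (x : EReal) : ℝ≥0∞ :=
  if x = ⊥ then 0 else if x = ⊤ then ⊤ else ENNReal.ofReal (Real.exp x.toReal)

/-- The logarithm on `ℝ≥0∞`, `log 0 = ⊥`, `log ∞ = ⊤`. -/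
def elog (x : ℝ≥0∞) : EReal :=
  if x = 0 then ⊥ else if x = ⊤ then ⊤ else ((Real.log x.toReal : ℝ) : EReal)

/-- The partition function `Σ_{ω ∈ {0,1}ⁿ} exp (t · sup_{x ∈ ⟨ω⟩} ψ^c_n(x))`. -/
def presZ (c : Torus) (t : ℝ) (n : ℕ) : ℝ≥0∞ :=
  ∑ ω : Fin n → Bool, eexp ((t : EReal) * ⨆ x ∈ cyl n ω, psiSum c n x)

/-- The upper topological pressure `P̄_top(t ψ^c)`. -/
def presUpper (c : Torus) (t : ℝ) : EReal :=
  atTop.limsup fun n : ℕ => (((n : ℝ)⁻¹ : ℝ) : EReal) * elog (presZ c t n)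

/-- The lower topological pressure `P̲_top(t ψ^c)`. -/
def presLower (c : Torus) (t : ℝ) : EReal :=
  atTop.liminf fun n : ℕ => (((n : ℝ)⁻¹ : ℝ) : EReal) * elog (presZ c t n)

/-- The `g`-function `g^c(x) = cos² (π (x - c))`. -/
def gfun (c : Torus) (x : Torus) : ℝ := (absCos (x - c)) ^ 2

/-- The halving map `x ↦ x/2` on the torus, computed on the representative in `[0,1)`. -/
def half (x : Torus) : Torus := (((AddCircle.equivIco 1 0 x : ℝ) / 2 : ℝ) : Torus)

/-- `μ` is a `g`-measure for `g^c`: it is a Borel probability measure invariant under the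
dual transfer operator of `g^c`. -/
def IsGMeasure (c : Torus) (μ : Measure Torus) : Prop :=
  IsProbabilityMeasure μ ∧
    ∀ f : C(Torus, ℝ),
      ∫ x, f x ∂μ =
        ∫ x,
          (gfun c (half x) * f (half x) +
            gfun c (half x + (((1 : ℝ) / 2 : ℝ) : Torus)) *
              f (half x + (((1 : ℝ) / 2 : ℝ) : Torus))) ∂μ

/-- `Σ_{ω ∈ {0,1}ⁿ} ν(⟨ω⟩)^q`. -/
def lqSum (ν : Measure Torus) (q : ℝ) (n : ℕ) : ℝ :=
  ∑ ω : Fin n → Bool, ((ν (cyl n ω)).toReal) ^ q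

/-- The upper `L^q`-spectrum `β̄_ν(q)`. -/
def lqUpper (ν : Measure Torus) (q : ℝ) : EReal :=
  atTop.limsup fun n : ℕ =>
    ((((n : ℝ) * Real.log 2)⁻¹ * Real.log (lqSum ν q n) : ℝ) : EReal)

/-- The lower `L^q`-spectrum `β̲_ν(q)`. -/
def lqLower (ν : Measure Torus) (q : ℝ) : EReal :=
  atTop.liminf fun n : ℕ =>
    ((((n : ℝ) * Real.log 2)⁻¹ * Real.log (lqSum ν q n) : ℝ) : EReal)

/-- The local dimension of `ν` at `x` equals `α`:
`lim_{r ↘ 0} log ν(B_r(x)) / log r = α` (closed balls). -/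
def HasLocDim (ν : Measure Torus) (x : Torus) (α : ℝ) : Prop :=
  Tendsto (fun r : ℝ => Real.log (ν (Metric.closedBall x r)).toReal / Real.log r)
    (𝓝[>] (0 : ℝ)) (𝓝 α)

/-- The Legendre transform `p*(a) = sup_{t ∈ ℝ} (t·a − p(t))` of the pressure function
`p(t) = P̄_top(t ψ^c)`. -/
def pStar (c : Torus) (a : ℝ) : EReal :=
  ⨆ t : ℝ, ((t * a : ℝ) : EReal) - presUpper c t

/-- `α̲_c = inf {a ∈ ℝ : p*(a) < ∞} ∈ ℝ ∪ {−∞}` (as an extended real). -/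
def alphaLower (c : Torus) : EReal :=
  sInf {e : EReal | ∃ a : ℝ, pStar c a < ⊤ ∧ e = (a : EReal)}

/-! ### Geometry of the circle -/

lemma exists_lift_abs_eq_norm (v : Torus) : ∃ t : ℝ, (t : Torus) = v ∧ |t| = ‖v‖ := by
  induction v using QuotientAddGroup.induction_on with
  | H z =>
    refine ⟨z - round z, ?_, ?_⟩
    · have : ((round z : ℝ) : Torus) = 0 := by
        rw [AddCircle.coe_eq_zero_iff]; exact ⟨round z, by simp⟩
      rw [AddCircle.coe_sub, this, sub_zero]
    · exact (UnitAddCircle.norm_eq (x := z)).symm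

lemma norm_coe_le_abs (t : ℝ) : ‖(t : Torus)‖ ≤ |t| := by
  rw [UnitAddCircle.norm_eq]
  simpa using round_le t 0

lemma coe_int (k : ℤ) : ((k : ℝ) : Torus) = 0 := by
  rw [AddCircle.coe_eq_zero_iff]; exact ⟨k, by simp⟩

lemma norm_le_half (v : Torus) : ‖v‖ ≤ 1 / 2 := by
  simpa using AddCircle.norm_le_half_period (x := v) (1 : ℝ) one_ne_zero

lemma norm_pow_two_nsmul_le (k : ℕ) (v : Torus) : ‖2 ^ k • v‖ ≤ 2 ^ k * ‖v‖ := by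
  have := norm_nsmul_le (n := 2 ^ k) (a := v)
  simpa [nsmul_eq_mul] using this

lemma norm_pow_two_nsmul_eq (k : ℕ) (v : Torus) (h : 2 ^ k * ‖v‖ ≤ 1 / 2) :
    ‖2 ^ k • v‖ = 2 ^ k * ‖v‖ := by
  obtain ⟨t, rfl, ht⟩ := exists_lift_abs_eq_norm v
  rw [← AddCircle.coe_nsmul, nsmul_eq_mul, ← ht]
  rw [← ht] at h
  have h2 : |((2 ^ k : ℕ) : ℝ) * t| = 2 ^ k * |t| := by
    rw [abs_mul]; simp
  rw [(AddCircle.norm_coe_eq_abs_iff (1 : ℝ) one_ne_zero).2, h2]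
  rw [h2]; simpa using h

lemma two_inv_ne : (((1 / 2 : ℝ)) : Torus) ≠ 0 := by
  intro h
  have := (AddCircle.norm_coe_eq_abs_iff (x := (1 / 2 : ℝ)) (1 : ℝ) one_ne_zero).2
    (by norm_num)
  rw [h] at this
  norm_num at this

lemma norm_half : ‖(((1 / 2 : ℝ)) : Torus)‖ = 1 / 2 := by
  rw [(AddCircle.norm_coe_eq_abs_iff (x := (1 / 2 : ℝ)) (1 : ℝ) one_ne_zero).2 (by norm_num)]
  norm_num

lemma half_add_half : (((1 / 2 : ℝ)) : Torus) + (((1 / 2 : ℝ)) : Torus) = 0 := by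
  rw [← AddCircle.coe_add]
  have := coe_int 1
  norm_num at this ⊢

lemma add_self_eq_add_self {p q : Torus} (h : p + p = q + q) :
    p = q ∨ p = q + ((1 / 2 : ℝ) : Torus) := by
  have h0 : (p - q) + (p - q) = 0 := by
    have : (p - q) + (p - q) = (p + p) - (q + q) := by abel
    rw [this, h, sub_self]
  obtain ⟨t, ht, -⟩ := exists_lift_abs_eq_norm (p - q)
  rw [← ht, ← AddCircle.coe_add, AddCircle.coe_eq_zero_iff] at h0
  obtain ⟨n, hn⟩ := h0
  have hn' : (n : ℝ) = 2 * t := by simpa [two_mul] using hn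
  rcases Int.even_or_odd' n with ⟨m, rfl | rfl⟩
  · left
    have : t = m := by push_cast at hn'; linarith
    rw [this, coe_int] at ht
    exact (sub_eq_zero.1 ht.symm)
  · right
    have : t = m + 1 / 2 := by push_cast at hn'; linarith
    rw [this, AddCircle.coe_add, coe_int, zero_add] at ht
    rw [ht]; abel

lemma exists_add_self_eq (y : Torus) : ∃ p : Torus, p + p = y := by
  obtain ⟨t, rfl, -⟩ := exists_lift_abs_eq_norm y
  exact ⟨((t / 2 : ℝ) : Torus), by rw [← AddCircle.coe_add]; congr 1; ring⟩

lemma dbl_iterate (k : ℕ) (x : Torus) : dbl^[k] x = 2 ^ k • x := by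
  induction k generalizing x with
  | zero => simp
  | succ k ih =>
    rw [Function.iterate_succ_apply, ih, dbl, ← two_nsmul, ← mul_nsmul, pow_succ]
    congr 1; ring

lemma nsmul_two_pow_add (k l : ℕ) (x : Torus) : 2 ^ (k + l) • x = 2 ^ l • (2 ^ k • x) := by
  rw [← mul_nsmul, pow_add]

/-! ### The amplitude function -/

lemma absCos_coe (t : ℝ) : absCos (t : Torus) = |Real.cos (Real.pi * t)| := rfl

lemma absCos_nonneg (v : Torus) : 0 ≤ absCos v := by
  obtain ⟨t, rfl, -⟩ := exists_lift_abs_eq_norm v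
  exact abs_nonneg _

lemma absCos_le_one (v : Torus) : absCos v ≤ 1 := by
  obtain ⟨t, rfl, -⟩ := exists_lift_abs_eq_norm v
  exact Real.abs_cos_le_one _

lemma absCos_le_add (v w : Torus) : absCos v ≤ absCos w + Real.pi * ‖v - w‖ := by
  obtain ⟨t, ht, ht'⟩ := exists_lift_abs_eq_norm (v - w)
  obtain ⟨y, rfl, -⟩ := exists_lift_abs_eq_norm w
  have hv : v = ((y + t : ℝ) : Torus) := by rw [AddCircle.coe_add, ht]; abel
  rw [← ht', hv, absCos_coe, absCos_coe]
  have h1 := Real.abs_cos_sub_cos_le (Real.pi * (y + t)) (Real.pi * y)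
  have h2 : |Real.pi * (y + t) - Real.pi * y| = Real.pi * |t| := by
    rw [← mul_sub, abs_mul, abs_of_pos Real.pi_pos]; congr 2; ring
  have h3 := abs_sub_abs_le_abs_sub (Real.cos (Real.pi * (y + t))) (Real.cos (Real.pi * y))
  linarith

lemma two_mul_norm_le_absCos (v : Torus) : 2 * ‖v - ((1 / 2 : ℝ) : Torus)‖ ≤ absCos v := by
  obtain ⟨t, ht, ht'⟩ := exists_lift_abs_eq_norm (v - ((1 / 2 : ℝ) : Torus))
  have hv : v = ((t + 1 / 2 : ℝ) : Torus) := by rw [AddCircle.coe_add, ht]; abel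
  have hb := norm_le_half (v - ((1 / 2 : ℝ) : Torus))
  rw [← ht'] at hb ⊢
  rw [hv, absCos_coe]
  have : Real.cos (Real.pi * (t + 1 / 2)) = - Real.sin (Real.pi * t) := by
    rw [← Real.cos_add_pi_div_two]; congr 1; ring
  rw [this, abs_neg]
  have h := Real.mul_abs_le_abs_sin (x := Real.pi * t) (by
    rw [abs_mul, abs_of_pos Real.pi_pos]; nlinarith [Real.pi_pos])
  rw [abs_mul, abs_of_pos Real.pi_pos] at h
  calc 2 * |t| = 2 / Real.pi * (Real.pi * |t|) := by field_simp
    _ ≤ _ := h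

lemma absCos_sq_le (v : Torus) : absCos v ^ 2 ≤ 1 - 4 * ‖v‖ ^ 2 := by
  obtain ⟨t, rfl, ht'⟩ := exists_lift_abs_eq_norm v
  have hb := norm_le_half (t : Torus)
  rw [← ht'] at hb ⊢
  rw [absCos_coe, sq_abs]
  have h := Real.mul_abs_le_abs_sin (x := Real.pi * t) (by
    rw [abs_mul, abs_of_pos Real.pi_pos]; nlinarith [Real.pi_pos])
  rw [abs_mul, abs_of_pos Real.pi_pos] at h
  have h2 : 2 * |t| ≤ |Real.sin (Real.pi * t)| := by
    calc 2 * |t| = 2 / Real.pi * (Real.pi * |t|) := by field_simp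
      _ ≤ _ := h
  have h3 : (2 * |t|) ^ 2 ≤ Real.sin (Real.pi * t) ^ 2 := by
    rw [← sq_abs (Real.sin _)]
    exact pow_le_pow_left₀ (by positivity) h2 2
  nlinarith [Real.sin_sq_add_cos_sq (Real.pi * t)]

/-- The square root `|cos (π (x - c))|` of the `g`-function. -/
def amp (c x : Torus) : ℝ := absCos (x - c)

/-- The singularity `c + 1/2`. -/
def sing (c : Torus) : Torus := c + ((1 / 2 : ℝ) : Torus)

lemma amp_nonneg (c x : Torus) : 0 ≤ amp c x := absCos_nonneg _

lemma amp_le_one (c x : Torus) : amp c x ≤ 1 := absCos_le_one _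

lemma amp_le_add (c x y : Torus) : amp c x ≤ amp c y + Real.pi * ‖x - y‖ := by
  simpa [amp] using absCos_le_add (x - c) (y - c)

lemma two_mul_norm_le_amp (c x : Torus) : 2 * ‖x - sing c‖ ≤ amp c x := by
  simpa [amp, sing, sub_add_eq_sub_sub] using two_mul_norm_le_absCos (x - c)

lemma gfun_eq (c x : Torus) : gfun c x = amp c x ^ 2 := rfl

lemma continuous_amp (c : Torus) : Continuous (amp c) := by
  refine Metric.continuous_iff.2 fun y ε hε => ⟨ε / Real.pi, by positivity, fun x hx => ?_⟩
  have h1 := amp_le_add c x y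
  have h2 := amp_le_add c y x
  rw [norm_sub_rev y x] at h2
  rw [dist_eq_norm] at hx
  have h3 : Real.pi * ‖x - y‖ < ε := by
    rw [lt_div_iff₀ Real.pi_pos] at hx; linarith
  rw [Real.dist_eq, abs_lt]
  constructor <;> linarith

lemma continuous_gfun (c : Torus) : Continuous (gfun c) := (continuous_amp c).pow 2

/-! ### Dyadic arcs -/

/-- The closed dyadic arc `[i / 2 ^ n, (i + 1) / 2 ^ n]` of the circle. -/
def arc (n : ℕ) (i : ℤ) : Set Torus := {x | ∃ u : ℝ, 0 ≤ u ∧ u ≤ 1 ∧ x = ((((i : ℝ) + u) / 2 ^ n : ℝ) : Torus)}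

/-- The left endpoint of a dyadic arc. -/
def pt (n : ℕ) (i : ℤ) : Torus := (((i : ℝ) / 2 ^ n : ℝ) : Torus)

lemma pow_nsmul_coe (k : ℕ) (t : ℝ) : 2 ^ k • (t : Torus) = ((2 ^ k * t : ℝ) : Torus) := by
  rw [← AddCircle.coe_nsmul, nsmul_eq_mul]; simp

lemma nsmul_mem_arc {n k : ℕ} {i : ℤ} {x : Torus} (hx : x ∈ arc (k + n) i) :
    2 ^ k • x ∈ arc n i := by
  obtain ⟨u, h0, h1, rfl⟩ := hx
  refine ⟨u, h0, h1, ?_⟩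
  rw [pow_nsmul_coe]; congr 1
  rw [pow_add]; field_simp

lemma norm_sub_pt_le {n : ℕ} {i : ℤ} {x : Torus} (hx : x ∈ arc n i) (i' : ℤ) :
    ‖x - pt n i'‖ ≤ (|(i : ℝ) - i'| + 1) / 2 ^ n := by
  obtain ⟨u, h0, h1, rfl⟩ := hx
  rw [pt, ← AddCircle.coe_sub]
  refine (norm_coe_le_abs _).trans ?_
  rw [← sub_div, abs_div, abs_of_pos (by positivity : (0 : ℝ) < 2 ^ n)]
  gcongr
  have : (i : ℝ) + u - i' = (i - i') + u := by ring
  rw [this]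
  refine (abs_add_le _ _).trans ?_
  rw [abs_of_nonneg h0]; linarith

lemma arc_eq_image (n : ℕ) (i : ℤ) : arc n i =
    (fun u : ℝ => ((((i : ℝ) + u) / 2 ^ n : ℝ) : Torus)) '' Icc 0 1 := by
  ext x; constructor
  · rintro ⟨u, h0, h1, rfl⟩; exact ⟨u, ⟨h0, h1⟩, rfl⟩
  · rintro ⟨u, ⟨h0, h1⟩, rfl⟩; exact ⟨u, h0, h1, rfl⟩

lemma isClosed_arc (n : ℕ) (i : ℤ) : IsClosed (arc n i) := by
  rw [arc_eq_image]
  refine (isCompact_Icc.image ?_).isClosed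
  exact (AddCircle.continuous_mk' 1).comp (by fun_prop)

lemma measurableSet_arc (n : ℕ) (i : ℤ) : MeasurableSet (arc n i) := (isClosed_arc n i).measurableSet

lemma arc_congr {n : ℕ} {i j : ℤ} (h : i ≡ j [ZMOD 2 ^ n]) : arc n i = arc n j := by
  have key : ∀ {i j : ℤ}, i ≡ j [ZMOD 2 ^ n] → arc n i ⊆ arc n j := by
    rintro i j h x ⟨u, h0, h1, rfl⟩
    refine ⟨u, h0, h1, ?_⟩
    obtain ⟨k, hk⟩ := h.dvd
    have : ((j : ℝ) + u) / 2 ^ n = (i + u) / 2 ^ n + (k : ℝ) := by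
      have hk' : (j : ℝ) - i = 2 ^ n * k := by exact_mod_cast hk
      rw [show (j : ℝ) = i + 2 ^ n * k by linarith]
      field_simp; ring
    rw [this, AddCircle.coe_add, coe_int, add_zero]
  exact (key h).antisymm (key h.symm)

lemma exists_mem_arc (n : ℕ) (x : Torus) : ∃ i : ℤ, x ∈ arc n i := by
  obtain ⟨t, rfl, -⟩ := exists_lift_abs_eq_norm x
  refine ⟨⌊2 ^ n * t⌋, Int.fract (2 ^ n * t), Int.fract_nonneg _, (Int.fract_lt_one _).le, ?_⟩
  rw [Int.floor_add_fract]; congr 1; field_simp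

lemma closedBall_subset_arcs {n : ℕ} {i : ℤ} {x : Torus} (hx : x ∈ arc n i) :
    Metric.closedBall x (1 / 2 ^ n) ⊆ arc n (i - 1) ∪ arc n i ∪ arc n (i + 1) := by
  intro y hy
  rw [Metric.mem_closedBall, dist_eq_norm] at hy
  obtain ⟨t, ht, ht'⟩ := exists_lift_abs_eq_norm (y - x)
  obtain ⟨u, h0, h1, rfl⟩ := hx
  rw [← ht', abs_le] at hy
  have h2 : (0 : ℝ) < 2 ^ n := by positivity
  have hyt : y = ((((i : ℝ) + (u + 2 ^ n * t)) / 2 ^ n : ℝ) : Torus) := by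
    have : ((i : ℝ) + (u + 2 ^ n * t)) / 2 ^ n = (i + u) / 2 ^ n + t := by field_simp; ring
    rw [this, AddCircle.coe_add, ht]; abel
  have hb1 : -1 ≤ 2 ^ n * t := by
    have := mul_le_mul_of_nonneg_left hy.1 h2.le
    rwa [mul_neg, mul_one_div_cancel h2.ne'] at this
  have hb2 : 2 ^ n * t ≤ 1 := by
    have := mul_le_mul_of_nonneg_left hy.2 h2.le
    rwa [mul_one_div_cancel h2.ne'] at this
  rcases lt_or_ge (u + 2 ^ n * t) 0 with h | h
  · left; left
    refine ⟨u + 2 ^ n * t + 1, by linarith, by linarith, ?_⟩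
    rw [hyt]; congr 2; push_cast; ring
  rcases le_or_gt (u + 2 ^ n * t) 1 with h' | h'
  · left; right
    exact ⟨u + 2 ^ n * t, h, h', hyt⟩
  · right
    refine ⟨u + 2 ^ n * t - 1, by linarith, by linarith, ?_⟩
    rw [hyt]; congr 2; push_cast; ring

lemma arc_subset_closedBall {n : ℕ} {i : ℤ} {x : Torus} (hx : x ∈ arc n i) :
    arc n i ⊆ Metric.closedBall x (1 / 2 ^ n) := by
  rintro y ⟨v, hv0, hv1, rfl⟩
  obtain ⟨u, h0, h1, rfl⟩ := hx
  rw [Metric.mem_closedBall, dist_eq_norm, ← AddCircle.coe_sub]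
  refine (norm_coe_le_abs _).trans ?_
  rw [← sub_div, abs_div, abs_of_pos (by positivity : (0 : ℝ) < 2 ^ n)]
  gcongr
  rw [abs_le]; constructor <;> linarith

lemma arc_add_half {n : ℕ} {i : ℤ} {y : Torus} (h1 : y ∈ arc (n + 1) i)
    (h2 : y + ((1 / 2 : ℝ) : Torus) ∈ arc (n + 1) i) : y + y = 0 := by
  obtain ⟨u, u0, u1, rfl⟩ := h1
  obtain ⟨v, v0, v1, hv⟩ := h2
  have h3 : (((v - u) / 2 ^ (n + 1) - 1 / 2 : ℝ) : Torus) = 0 := by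
    have : (v - u) / 2 ^ (n + 1) - 1 / 2 =
        ((i : ℝ) + v) / 2 ^ (n + 1) - ((i + u) / 2 ^ (n + 1) + 1 / 2) := by ring
    rw [this, AddCircle.coe_sub, AddCircle.coe_add, hv, sub_self]
  rw [AddCircle.coe_eq_zero_iff] at h3
  obtain ⟨k, hk⟩ := h3
  have hk' : (k : ℝ) = (v - u) / 2 ^ (n + 1) - 1 / 2 := by simpa using hk
  have hle : (2 : ℝ) ≤ 2 ^ (n + 1) := by
    rw [pow_succ]; nlinarith [one_le_pow₀ (one_le_two : (1 : ℝ) ≤ 2) (n := n)]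
  have hpos : (0 : ℝ) < 2 ^ (n + 1) := by positivity
  have habs : |(v - u) / 2 ^ (n + 1)| ≤ 1 / 2 := by
    rw [abs_div, abs_of_pos hpos, div_le_iff₀ hpos]
    have : |v - u| ≤ 1 := by rw [abs_le]; constructor <;> linarith
    linarith
  rw [abs_le] at habs
  have hk1 : -1 ≤ k := by
    have : (-1 : ℝ) ≤ k := by linarith
    exact_mod_cast this
  have hk2 : k ≤ 0 := by
    have : (k : ℝ) ≤ 0 := by linarith
    exact_mod_cast this
  have hn : (2 : ℝ) ^ (n + 1) ≤ 2 := by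
    by_contra hcon
    push Not at hcon
    have : |(v - u) / 2 ^ (n + 1)| < 1 / 2 := by
      rw [abs_div, abs_of_pos hpos, div_lt_iff₀ hpos]
      have : |v - u| ≤ 1 := by rw [abs_le]; constructor <;> linarith
      linarith
    rw [abs_lt] at this
    have e1 : (-1 : ℝ) < k := by linarith
    have e2 : (k : ℝ) < 0 := by linarith
    have e1' : -1 < k := by exact_mod_cast e1
    have e2' : k < 0 := by exact_mod_cast e2
    omega
  have hn2 : (2 : ℝ) ^ (n + 1) = 2 := le_antisymm hn hle
  rw [hn2] at hk' ⊢
  rw [← AddCircle.coe_add]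
  have hk3 : k = -1 ∨ k = 0 := by omega
  have hu : u = 0 ∨ u = 1 := by
    rcases hk3 with rfl | rfl
    · right; push_cast at hk'; linarith
    · left; push_cast at hk'; linarith
  rcases hu with rfl | rfl
  · rw [← coe_int i]; congr 1; ring
  · rw [← coe_int (i + 1)]; congr 1; push_cast; ring

lemma exists_mem_arc_add_self {n : ℕ} {i : ℤ} {x : Torus} (hx : x ∈ arc n i) :
    ∃ y ∈ arc (n + 1) i, y + y = x := by
  obtain ⟨u, h0, h1, rfl⟩ := hx
  refine ⟨_, ⟨u, h0, h1, rfl⟩, ?_⟩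
  rw [← AddCircle.coe_add]; congr 1; rw [pow_succ]; field_simp; norm_num

lemma add_self_mem_arc {n : ℕ} {i : ℤ} {x : Torus} (hx : x ∈ arc (n + 1) i) :
    x + x ∈ arc n i := by
  rw [add_comm] at hx
  simpa [two_nsmul] using nsmul_mem_arc (k := 1) hx

/-! ### The transfer identity for `g`-measures -/

lemma half_add_self (x : Torus) : half x + half x = x := by
  rw [half, ← AddCircle.coe_add, add_halves]
  exact (AddCircle.equivIco 1 0).symm_apply_apply x

lemma eq_half_or {x y : Torus} (h : y + y = x) :
    y = half x ∨ y = half x + ((1 / 2 : ℝ) : Torus) :=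
  add_self_eq_add_self (by rw [h, half_add_self])

lemma measurable_half : Measurable half := by
  have h1 : Measurable fun x : Torus => (AddCircle.equivIco 1 0 x : ℝ) :=
    measurable_subtype_coe.comp (AddCircle.measurableEquivIco 1 0).measurable
  exact AddCircle.measurable_mk'.comp (h1.div_const 2)

lemma measurable_half_add : Measurable fun x => half x + ((1 / 2 : ℝ) : Torus) :=
  (measurable_add_const _).comp measurable_half

section GMeasure

variable {c : Torus} {μ : Measure Torus}

lemma IsGMeasure.measure_eq_lintegral (hμ : IsGMeasure c μ) {S : Set Torus}
    (hS : MeasurableSet S) :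
    μ S = ∫⁻ x, (S.indicator (fun y => ENNReal.ofReal (gfun c y)) (half x) +
      S.indicator (fun y => ENNReal.ofReal (gfun c y)) (half x + ((1 / 2 : ℝ) : Torus))) ∂μ := by
  obtain ⟨hprob, hint⟩ := hμ
  have hg : Measurable fun y => ENNReal.ofReal (gfun c y) :=
    (continuous_gfun c).measurable.ennreal_ofReal
  have hgb : ∀ y, ENNReal.ofReal (gfun c y) ≤ 1 := fun y => by
    rw [ENNReal.ofReal_le_one, gfun_eq]
    exact pow_le_one₀ (amp_nonneg c y) (amp_le_one c y)
  have hg0 : ∀ y, 0 ≤ gfun c y := fun y => sq_nonneg _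
  have hfin : ∀ f : Torus → Torus, Measurable f →
      IsFiniteMeasure (μ.withDensity fun x => ENNReal.ofReal (gfun c (f x))) := fun f hf => by
    refine isFiniteMeasure_withDensity (ne_of_lt ?_)
    calc ∫⁻ x, ENNReal.ofReal (gfun c (f x)) ∂μ ≤ ∫⁻ _, 1 ∂μ := lintegral_mono fun x => hgb _
      _ < ⊤ := by simp
  have hf1 := hfin _ measurable_half
  have hf2 := hfin _ measurable_half_add
  set ν : Measure Torus := (μ.withDensity fun x => ENNReal.ofReal (gfun c (half x))).map half +
    (μ.withDensity fun x => ENNReal.ofReal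
      (gfun c (half x + ((1 / 2 : ℝ) : Torus)))).map (fun x => half x + ((1 / 2 : ℝ) : Torus)) with hν
  have hintegrable : ∀ (f : BoundedContinuousFunction Torus ℝ) (F : Torus → Torus), Measurable F →
      Integrable (fun x => gfun c (F x) * f (F x)) μ := fun f F hF => by
    refine Integrable.of_bound (C := ‖f‖) ?_ (Eventually.of_forall fun x => ?_)
    · exact (((continuous_gfun c).mul f.continuous).measurable.comp hF).aestronglyMeasurable
    · rw [norm_mul, Real.norm_of_nonneg (hg0 _)]
      have := hgb (F x)
      rw [ENNReal.ofReal_le_one] at this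
      exact (mul_le_mul this (f.norm_coe_le_norm _) (norm_nonneg _) zero_le_one).trans
        (one_mul _).le
  have hpiece : ∀ (f : BoundedContinuousFunction Torus ℝ) (F : Torus → Torus), Measurable F →
      ∫ x, f x ∂((μ.withDensity fun x => ENNReal.ofReal (gfun c (F x))).map F) =
        ∫ x, gfun c (F x) * f (F x) ∂μ := fun f F hF => by
    rw [integral_map hF.aemeasurable f.continuous.aestronglyMeasurable,
      integral_withDensity_eq_integral_toReal_smul
        (show Measurable fun x => ENNReal.ofReal (gfun c (F x)) from hg.comp hF)
        (Eventually.of_forall fun x => ENNReal.ofReal_lt_top)]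
    refine integral_congr_ae (Eventually.of_forall fun x => ?_)
    simp [ENNReal.toReal_ofReal (hg0 _)]
  have heq : μ = ν := by
    refine ext_of_forall_integral_eq_of_IsFiniteMeasure fun f => ?_
    have h1 := hint f.toContinuousMap
    simp only [BoundedContinuousFunction.coe_toContinuousMap] at h1
    rw [h1, hν, integral_add_measure (f.integrable _) (f.integrable _),
      hpiece f _ measurable_half, hpiece f _ measurable_half_add,
      integral_add (hintegrable f _ measurable_half) (hintegrable f _ measurable_half_add)]
  have hpm : ∀ F : Torus → Torus, Measurable F →
      ((μ.withDensity fun x => ENNReal.ofReal (gfun c (F x))).map F) S =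
        ∫⁻ x, S.indicator (fun y => ENNReal.ofReal (gfun c y)) (F x) ∂μ := fun F hF => by
    rw [Measure.map_apply hF hS, withDensity_apply _ (hF hS), ← lintegral_indicator (hF hS)]
    rfl
  rw [lintegral_add_left (show Measurable fun x => S.indicator
      (fun y => ENNReal.ofReal (gfun c y)) (half x) from (hg.indicator hS).comp measurable_half), ← hpm _ measurable_half,
    ← hpm _ measurable_half_add]
  conv_lhs => rw [heq, hν]
  rfl

lemma IsGMeasure.mul_measure_le (hμ : IsGMeasure c μ) {K B : Set Torus} (hK : MeasurableSet K)
    (hB : MeasurableSet B) {l : ℝ≥0∞}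
    (h : ∀ x ∈ B, ∃ y ∈ K, y + y = x ∧ l ≤ ENNReal.ofReal (gfun c y)) : l * μ B ≤ μ K := by
  rw [hμ.measure_eq_lintegral hK, ← lintegral_indicator_const hB]
  refine lintegral_mono fun x => ?_
  by_cases hx : x ∈ B
  · obtain ⟨y, hy, hyx, hl⟩ := h x hx
    rw [indicator_of_mem hx]
    rcases eq_half_or hyx with rfl | rfl
    · exact le_add_right (by rw [indicator_of_mem hy]; exact hl)
    · exact le_add_left (by rw [indicator_of_mem hy]; exact hl)
  · rw [indicator_of_notMem hx]; exact zero_le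

lemma IsGMeasure.measure_le_mul (hμ : IsGMeasure c μ) (h0 : μ {0} = 0) {K B : Set Torus}
    (hK : MeasurableSet K) (hB : MeasurableSet B) {l : ℝ≥0∞}
    (h : ∀ y ∈ K, y + y ∈ B ∧ ENNReal.ofReal (gfun c y) ≤ l)
    (h2 : ∀ y ∈ K, y + ((1 / 2 : ℝ) : Torus) ∈ K → y + y = 0) : μ K ≤ l * μ B := by
  rw [hμ.measure_eq_lintegral hK, ← lintegral_indicator_const hB]
  refine lintegral_mono_ae ?_
  have hne : ∀ᵐ x ∂μ, x ≠ 0 := by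
    rw [ae_iff]; simpa using h0
  filter_upwards [hne] with x hx
  by_cases h3 : half x ∈ K
  · have h4 : half x + ((1 / 2 : ℝ) : Torus) ∉ K := fun h4 => hx (by
      rw [← half_add_self x]; exact h2 _ h3 h4)
    have := h _ h3
    rw [half_add_self] at this
    rw [indicator_of_mem h3, indicator_of_notMem h4, add_zero, indicator_of_mem this.1]
    exact this.2
  · rw [indicator_of_notMem h3, zero_add]
    by_cases h4 : half x + ((1 / 2 : ℝ) : Torus) ∈ K
    · have := h _ h4
      have e : half x + ((1 / 2 : ℝ) : Torus) + (half x + ((1 / 2 : ℝ) : Torus)) = x := by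
        rw [add_add_add_comm, half_add_self, half_add_half, add_zero]
      rw [e] at this
      rw [indicator_of_mem h4, indicator_of_mem this.1]
      exact this.2
    · rw [indicator_of_notMem h4]; exact zero_le

/-- Upper one-step estimate for dyadic arcs. -/
lemma IsGMeasure.real_arc_succ_le (hμ : IsGMeasure c μ) (h0 : μ {0} = 0) (n : ℕ) (i : ℤ) {l : ℝ}
    (hl : ∀ y ∈ arc (n + 1) i, amp c y ≤ l) :
    μ.real (arc (n + 1) i) ≤ l ^ 2 * μ.real (arc n i) := by
  have := hμ.1
  have h := hμ.measure_le_mul h0 (measurableSet_arc (n + 1) i) (measurableSet_arc n i)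
    (l := ENNReal.ofReal (l ^ 2))
    (fun y hy => ⟨add_self_mem_arc hy, ENNReal.ofReal_le_ofReal
      (pow_le_pow_left₀ (amp_nonneg c y) (hl y hy) 2)⟩) (fun y => arc_add_half)
  have h2 := ENNReal.toReal_mono (ENNReal.mul_ne_top ENNReal.ofReal_ne_top (measure_ne_top _ _)) h
  rwa [ENNReal.toReal_mul, ENNReal.toReal_ofReal (sq_nonneg _)] at h2

/-- Lower one-step estimate for the part of a dyadic arc which is mapped into a given set. -/
lemma IsGMeasure.mul_real_le_arc_succ (hμ : IsGMeasure c μ) (n : ℕ) (i : ℤ) {l : ℝ}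
    (hl0 : 0 ≤ l) {B : Set Torus} (hB : MeasurableSet B)
    (hl : ∀ y ∈ arc (n + 1) i, y + y ∈ B → l ≤ amp c y) :
    l ^ 2 * μ.real (arc n i ∩ B) ≤ μ.real (arc (n + 1) i ∩ (fun y => y + y) ⁻¹' B) := by
  have := hμ.1
  have hm : Measurable fun y : Torus => y + y := (continuous_id.add continuous_id).measurable
  have h := hμ.mul_measure_le ((measurableSet_arc (n + 1) i).inter (hm hB))
    ((measurableSet_arc n i).inter hB)
    (l := ENNReal.ofReal (l ^ 2)) (fun x hx => by
      obtain ⟨y, hy, rfl⟩ := exists_mem_arc_add_self hx.1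
      exact ⟨y, ⟨hy, hx.2⟩, rfl, ENNReal.ofReal_le_ofReal
        (pow_le_pow_left₀ hl0 (hl y hy hx.2) 2)⟩)
  have h2 := ENNReal.toReal_mono (measure_ne_top _ _) h
  rwa [ENNReal.toReal_mul, ENNReal.toReal_ofReal (sq_nonneg _)] at h2

end GMeasure

/-! ### Upper amplitudes on dyadic arcs -/

/-- An upper bound for the amplitude on a dyadic arc. -/
def upAmp (c : Torus) (j : ℕ) (i : ℤ) : ℝ := amp c (pt j i) + Real.pi / 2 ^ j

/-- An upper bound for the logarithm of the product of the amplitudes along an orbit segment of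
length `n` starting in a dyadic arc of level `n`. -/
def logUp (c : Torus) (n : ℕ) (i : ℤ) : ℝ := ∑ j ∈ Finset.range n, Real.log (upAmp c (j + 1) i)

/-- The logarithm of the product of the amplitudes along an orbit segment. -/
def logAmp (c : Torus) (n : ℕ) (x : Torus) : ℝ := ∑ k ∈ Finset.range n, Real.log (amp c (2 ^ k • x))

lemma upAmp_pos (c : Torus) (j : ℕ) (i : ℤ) : 0 < upAmp c j i := by
  have := amp_nonneg c (pt j i)
  unfold upAmp
  have := Real.pi_pos
  positivity

lemma amp_le_upAmp (c : Torus) {j : ℕ} {i : ℤ} {x : Torus} (hx : x ∈ arc j i) :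
    amp c x ≤ upAmp c j i := by
  have h1 := amp_le_add c x (pt j i)
  have h2 := norm_sub_pt_le hx i
  rw [sub_self, abs_zero, zero_add] at h2
  have h3 := mul_le_mul_of_nonneg_left h2 Real.pi_pos.le
  rw [mul_one_div] at h3
  unfold upAmp
  linarith

lemma upAmp_le_amp_add (c : Torus) {j : ℕ} {i : ℤ} {x : Torus} (hx : x ∈ arc j i) (i' : ℤ) :
    upAmp c j i' ≤ amp c x + (|(i : ℝ) - i'| + 2) * Real.pi / 2 ^ j := by
  have h1 := amp_le_add c (pt j i') x
  rw [norm_sub_rev] at h1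
  have h3 := mul_le_mul_of_nonneg_left (norm_sub_pt_le hx i') Real.pi_pos.le
  have h4 : (|(i : ℝ) - i'| + 2) * Real.pi / 2 ^ j =
    Real.pi * ((|(i : ℝ) - i'| + 1) / 2 ^ j) + Real.pi / 2 ^ j := by ring
  unfold upAmp
  linarith

lemma log_upAmp_le (c : Torus) (j : ℕ) (i : ℤ) : Real.log (upAmp c j i) ≤ 2 := by
  rw [Real.log_le_iff_le_exp (upAmp_pos c j i)]
  have h1 := amp_le_one c (pt j i)
  have h2 : Real.pi / 2 ^ j ≤ Real.pi := div_le_self Real.pi_pos.le (one_le_pow₀ one_le_two)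
  have h3 := Real.pi_lt_d2
  have h4 : (2.7 : ℝ) ≤ Real.exp 1 := by have := Real.exp_one_gt_d9; norm_num at this ⊢; linarith
  have h5 : Real.exp 2 = Real.exp 1 * Real.exp 1 := by rw [← Real.exp_add]; norm_num
  unfold upAmp
  nlinarith

lemma logAmp_eq_sum_reflect (c : Torus) (n : ℕ) (x : Torus) :
    logAmp c n x = ∑ j ∈ Finset.range n, Real.log (amp c (2 ^ (n - 1 - j) • x)) :=
  (Finset.sum_range_reflect (fun k => Real.log (amp c (2 ^ k • x))) n).symm

lemma nsmul_sub_mem_arc {n : ℕ} {i : ℤ} {x : Torus} (hx : x ∈ arc n i) {j : ℕ} (hj : j < n) :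
    2 ^ (n - 1 - j) • x ∈ arc (j + 1) i :=
  nsmul_mem_arc (by rwa [show n - 1 - j + (j + 1) = n by omega])

lemma logAmp_le_logUp {c : Torus} {n : ℕ} {i : ℤ} {x : Torus} (hx : x ∈ arc n i)
    (hpos : ∀ k < n, 0 < amp c (2 ^ k • x)) : logAmp c n x ≤ logUp c n i := by
  rw [logAmp_eq_sum_reflect, logUp]
  refine Finset.sum_le_sum fun j hj => ?_
  rw [Finset.mem_range] at hj
  exact Real.log_le_log (hpos _ (by omega)) (amp_le_upAmp c (nsmul_sub_mem_arc hx hj))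

lemma pt_congr {n : ℕ} {i j : ℤ} (h : i ≡ j [ZMOD 2 ^ n]) : pt n i = pt n j := by
  obtain ⟨k, hk⟩ := h.dvd
  have hk' : (j : ℝ) = i + 2 ^ n * k := by
    have : j = i + 2 ^ n * k := by omega
    exact_mod_cast this
  have : (j : ℝ) / 2 ^ n = i / 2 ^ n + (k : ℝ) := by rw [hk']; field_simp
  rw [pt, pt, this, AddCircle.coe_add, coe_int, add_zero]

lemma logUp_congr (c : Torus) {n : ℕ} {i j : ℤ} (h : i ≡ j [ZMOD 2 ^ n]) :
    logUp c n i = logUp c n j := by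
  refine Finset.sum_congr rfl fun k hk => ?_
  rw [Finset.mem_range] at hk
  rw [upAmp, upAmp, pt_congr (h.of_dvd (pow_dvd_pow 2 hk))]

lemma IsGMeasure.real_arc_le {c : Torus} {μ : Measure Torus} (hμ : IsGMeasure c μ) (h0 : μ {0} = 0)
    (n : ℕ) (i : ℤ) : μ.real (arc n i) ≤ Real.exp (2 * logUp c n i) := by
  have := hμ.1
  induction n with
  | zero => simp [logUp]
  | succ n ih =>
    have h1 := hμ.real_arc_succ_le h0 n i (fun y hy => amp_le_upAmp c hy)
    have h2 : Real.exp (2 * logUp c (n + 1) i) =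
        upAmp c (n + 1) i ^ 2 * Real.exp (2 * logUp c n i) := by
      rw [logUp, Finset.sum_range_succ, mul_add, Real.exp_add, mul_comm]
      congr 1
      rw [two_mul, Real.exp_add, Real.exp_log (upAmp_pos _ _ _), sq]
    rw [h2]
    exact h1.trans (mul_le_mul_of_nonneg_left ih (sq_nonneg _))

/-! ### Decay of the mass of small balls -/

lemma IsGMeasure.real_arc_add_two_le {c : Torus} {μ : Measure Torus} (hμ : IsGMeasure c μ)
    (h0 : μ {0} = 0) {r : ℝ} (hr0 : 0 ≤ r) (hr : 4 * r ≤ ‖c‖) {n : ℕ} (hn : 1 / 2 ^ (n + 1) ≤ r)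
    (i : ℤ) : μ.real (arc (n + 2) i) ≤ (1 - 4 * r ^ 2) * μ.real (arc n i) := by
  have hs : 0 ≤ 1 - 4 * r ^ 2 := by nlinarith [norm_le_half c]
  have hamp : ∀ y, r ≤ ‖y - c‖ → amp c y ≤ √(1 - 4 * r ^ 2) := fun y hy => by
    refine Real.le_sqrt_of_sq_le ((absCos_sq_le (y - c)).trans ?_)
    nlinarith
  have hA0 : 0 ≤ μ.real (arc n i) := measureReal_nonneg
  have hA1 : 0 ≤ μ.real (arc (n + 1) i) := measureReal_nonneg
  by_cases h : ∀ y ∈ arc (n + 2) i, r ≤ ‖y - c‖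
  · have h1 := hμ.real_arc_succ_le h0 (n + 1) i (fun y hy => hamp y (h y hy))
    have h2 := hμ.real_arc_succ_le h0 n i (fun y _ => amp_le_one c y)
    rw [Real.sq_sqrt hs] at h1
    nlinarith
  · push Not at h
    obtain ⟨x, hx, hxc⟩ := h
    have h1 := hμ.real_arc_succ_le h0 n i (fun y hy => hamp y (by
      have h3 := arc_subset_closedBall (add_self_mem_arc hx) hy
      rw [Metric.mem_closedBall, dist_eq_norm] at h3
      have h4 : c = (y - c) - (y - (x + x)) - (x - c) - (x - c) := by abel
      have h5 : ‖c‖ ≤ ‖y - c‖ + ‖y - (x + x)‖ + ‖x - c‖ + ‖x - c‖ := by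
        conv_lhs => rw [h4]
        exact (norm_sub_le _ _).trans (add_le_add ((norm_sub_le _ _).trans
          (add_le_add (norm_sub_le _ _) le_rfl)) le_rfl)
      linarith))
    have h2 := hμ.real_arc_succ_le h0 (n + 1) i (fun y _ => amp_le_one c y)
    rw [Real.sq_sqrt hs] at h1
    nlinarith

lemma IsGMeasure.exists_real_closedBall_le {c : Torus} (hc : c ≠ 0) {μ : Measure Torus}
    (hμ : IsGMeasure c μ) (h0 : μ {0} = 0) :
    ∃ κ C : ℝ, 0 < κ ∧ κ < 1 ∧ 0 < C ∧
      ∀ (m : ℕ) (z : Torus), μ.real (Metric.closedBall z (1 / 2 ^ (2 * m + 3))) ≤ C * κ ^ m := by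
  have := hμ.1
  have hc' := norm_pos_iff.2 hc
  have hch := norm_le_half c
  obtain ⟨N, hN⟩ := exists_pow_lt_of_lt_one (show 0 < ‖c‖ / 4 by positivity)
    (show (1 / 2 : ℝ) < 1 by norm_num)
  set κ := 1 - 4 * (‖c‖ / 4) ^ 2 with hκ
  have hκ0 : 0 < κ := by nlinarith
  have hκ1 : κ < 1 := by nlinarith
  have hdecay : ∀ k i, μ.real (arc (N + 2 * k) i) ≤ κ ^ k := fun k i => by
    induction k with
    | zero => simp
    | succ k ih =>
      have h1 := hμ.real_arc_add_two_le h0 (r := ‖c‖ / 4) (by positivity) (by linarith)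
        (n := N + 2 * k) (by
          refine le_trans ?_ hN.le
          rw [one_div_pow]
          exact one_div_le_one_div_of_le (by positivity)
            (pow_le_pow_right₀ one_le_two (by omega))) i
      rw [pow_succ, mul_comm (κ ^ k)]
      exact h1.trans (mul_le_mul_of_nonneg_left ih hκ0.le)
  refine ⟨κ, 3 / κ ^ N, hκ0, hκ1, by positivity, fun m z => ?_⟩
  rcases lt_or_ge m N with hm | hm
  · have h1 : μ.real (Metric.closedBall z (1 / 2 ^ (2 * m + 3))) ≤ 1 := measureReal_le_one
    refine h1.trans ?_
    rw [div_mul_eq_mul_div, le_div_iff₀ (by positivity)]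
    have : κ ^ N ≤ κ ^ m := pow_le_pow_of_le_one hκ0.le hκ1.le hm.le
    have : 0 < κ ^ m := by positivity
    linarith
  · obtain ⟨i, hi⟩ := exists_mem_arc (N + 2 * (m - N)) z
    have h1 : Metric.closedBall z (1 / 2 ^ (2 * m + 3)) ⊆ _ :=
      (Metric.closedBall_subset_closedBall (one_div_le_one_div_of_le (by positivity)
        (pow_le_pow_right₀ one_le_two (by omega)))).trans (closedBall_subset_arcs hi)
    have h2 := (measureReal_mono (μ := μ) h1).trans ((measureReal_union_le _ _).trans
      (add_le_add (measureReal_union_le _ _) le_rfl))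
    have h3 : 3 / κ ^ N * κ ^ m = 3 * κ ^ (m - N) := by
      rw [pow_sub₀ _ hκ0.ne' hm]; ring
    rw [h3]
    linarith [hdecay (m - N) (i - 1), hdecay (m - N) i, hdecay (m - N) (i + 1)]

/-! ### Distortion -/

/-- The (rounded down) fourth root. -/
def root4 (n : ℕ) : ℕ := Nat.sqrt (Nat.sqrt n)

lemma root4_pow_le (n : ℕ) : root4 n ^ 4 ≤ n := by
  have h1 := Nat.sqrt_le' n
  have h2 := Nat.sqrt_le' (Nat.sqrt n)
  calc root4 n ^ 4 = (root4 n ^ 2) ^ 2 := by ring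
    _ ≤ (Nat.sqrt n) ^ 2 := Nat.pow_le_pow_left h2 2
    _ ≤ n := h1

lemma lt_root4_succ_pow (n : ℕ) : n < (root4 n + 1) ^ 4 := by
  have h1 := Nat.lt_succ_sqrt' n
  have h2 := Nat.lt_succ_sqrt' (Nat.sqrt n)
  calc n < (Nat.sqrt n + 1) ^ 2 := h1
    _ ≤ ((root4 n + 1) ^ 2) ^ 2 := Nat.pow_le_pow_left h2 2
    _ = (root4 n + 1) ^ 4 := by ring

lemma root4_mono : Monotone root4 := fun _ _ h => Nat.sqrt_le_sqrt (Nat.sqrt_le_sqrt h)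

lemma tendsto_root4 : Tendsto root4 atTop atTop := by
  refine root4_mono.tendsto_atTop_atTop fun b => ⟨b ^ 4, ?_⟩
  have := lt_root4_succ_pow (b ^ 4)
  have := lt_of_pow_lt_pow_left₀ 4 (by omega) this
  omega

/-- The product of the amplitudes along an orbit segment starting in the dyadic arc `arc n i` is
comparable to its upper bound, provided that the end point of the segment avoids small balls around
finitely many points. -/
def Distorted (c : Torus) (ε : ℝ) (n : ℕ) (i : ℤ) : Prop :=
  ∃ Z : Finset Torus, Z.card ≤ n ∧ ∃ l : ℕ → ℝ, (∀ j, 0 < l j) ∧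
    logUp c n i - ε * n ≤ ∑ j ∈ Finset.range n, Real.log (l j) ∧
    ∀ j < n, ∀ x ∈ arc (j + 1) i,
      (∀ z ∈ Z, 1 / 2 ^ (2 * root4 n + 3) ≤ ‖2 ^ (j + 1) • x - z‖) → l j ≤ amp c x

lemma exp_neg_two_mul_le {τ : ℝ} (h0 : 0 ≤ τ) (h1 : τ ≤ 1 / 2) : Real.exp (-(2 * τ)) ≤ 1 - τ := by
  rw [Real.exp_neg]
  have h2 := Real.add_one_le_exp (2 * τ)
  have h3 := Real.exp_pos (2 * τ)
  rw [inv_le_iff_one_le_mul₀ h3]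
  nlinarith

/-- A set of natural numbers with small sum has few elements. -/
lemma card_le_add_sum_div (B : Finset ℕ) {T : ℕ} (hT : 0 < T) :
    (B.card : ℝ) ≤ T + (∑ j ∈ B, ((j : ℝ) + 1)) / T := by
  have hT' : (0 : ℝ) < T := by exact_mod_cast hT
  rw [← Finset.card_filter_add_card_filter_not (fun j => j < T) (s := B)]
  push_cast
  refine add_le_add ?_ ?_
  · have : (B.filter fun j => j < T) ⊆ Finset.range T := fun j hj => by
      rw [Finset.mem_filter] at hj; exact Finset.mem_range.2 hj.2
    have := Finset.card_le_card this
    rw [Finset.card_range] at this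
    exact_mod_cast this
  · rw [le_div_iff₀ hT', ← nsmul_eq_mul]
    refine (Finset.card_nsmul_le_sum _ (fun j : ℕ => (j : ℝ) + 1) _ fun j hj => ?_).trans
      (Finset.sum_le_sum_of_subset_of_nonneg (Finset.filter_subset _ B) fun _ _ _ => by positivity)
    rw [Finset.mem_filter, not_lt] at hj
    have : (T : ℝ) ≤ j := by exact_mod_cast hj.2
    linarith

lemma eventually_distorted (c : Torus) {A ε : ℝ} (hA : 0 ≤ A) (hε : 0 < ε) :
    ∀ᶠ n : ℕ in atTop, ∀ i, -A * n ≤ logUp c n i → Distorted c ε n i := by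
  have hπ := Real.pi_gt_three
  have hl2 : 0 < Real.log 2 := Real.log_pos one_lt_two
  obtain ⟨τ, hτ0, hτ1, hτ2⟩ : ∃ τ : ℝ, 0 < τ ∧ τ ≤ 1 / 2 ∧ 2 * τ ≤ ε / 2 :=
    ⟨min (1 / 2) (ε / 4), lt_min (by norm_num) (by positivity), min_le_left _ _, by
      linarith [min_le_right (1 / 2) (ε / 4)]⟩
  have hπτ : 1 < Real.pi / τ := by rw [lt_div_iff₀ hτ0]; linarith
  have hπτ2 : 1 < 2 * Real.pi / τ := by rw [lt_div_iff₀ hτ0]; linarith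
  set K1 := Real.log (2 * Real.pi / τ) with hK1
  have hK1p : 0 < K1 := Real.log_pos hπτ2
  set K := (A + 2 + K1) / Real.log 2 with hK
  have hKp : 0 < K := by positivity
  set K3 := Real.log (Real.pi / τ) + 5 * Real.log 2 with hK3
  have hK3p : 0 < K3 := by have := Real.log_pos hπτ; positivity
  have hbig : ∀ᶠ n : ℕ in atTop, 2 * K3 * (1 + K) / ε + 1 ≤ root4 n :=
    (tendsto_natCast_atTop_atTop.comp tendsto_root4).eventually_ge_atTop _
  filter_upwards [hbig] with n hn i hi
  have hm4 : ((root4 n : ℝ)) ^ 4 ≤ n := by exact_mod_cast root4_pow_le n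
  set m := root4 n
  have hm1 : (1 : ℝ) ≤ m := by
    have : 0 ≤ 2 * K3 * (1 + K) / ε := by positivity
    linarith
  have hm1' : 1 ≤ m := by exact_mod_cast hm1
  set η : ℝ := 1 / 2 ^ (2 * m + 3) with hη
  have hη0 : 0 < η := by positivity
  set B := (Finset.range n).filter fun j => upAmp c (j + 1) i * τ < 2 * Real.pi / 2 ^ (j + 1) with hB
  set l : ℕ → ℝ := fun j => if upAmp c (j + 1) i * τ < 2 * Real.pi / 2 ^ (j + 1) then
    2 * (η / 2 ^ (j + 1)) else upAmp c (j + 1) i * Real.exp (-(2 * τ)) with hl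
  have hU := fun j => upAmp_pos c (j + 1) i
  classical
  refine ⟨(Finset.range n).image fun j => 2 ^ (j + 1) • sing c,
    Finset.card_image_le.trans (Finset.card_range n).le, l, fun j => ?_, ?_, ?_⟩
  · simp only [hl]
    have := hU j
    split_ifs <;> positivity
  · have hlogU : ∀ j ∈ B, Real.log (upAmp c (j + 1) i) ≤ K1 - Real.log 2 * (j + 1) := by
      intro j hj
      rw [hB, Finset.mem_filter, ← lt_div_iff₀ hτ0] at hj
      have h1 := Real.log_le_log (hU j) hj.2.le
      have h2 : 2 * Real.pi / 2 ^ (j + 1) / τ = (2 * Real.pi / τ) / 2 ^ (j + 1) := by ring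
      rw [h2, Real.log_div (by positivity) (by positivity), Real.log_pow] at h1
      push_cast at h1
      linarith
    have hBn : (B.card : ℝ) ≤ n := by
      have : B.card ≤ (Finset.range n).card := Finset.card_filter_le _ _
      rw [Finset.card_range] at this
      exact_mod_cast this
    have hsumB : ∑ j ∈ B, ((j : ℝ) + 1) ≤ K * n := by
      have h1 : logUp c n i ≤ ∑ j ∈ Finset.range n, (2 : ℝ) +
          ∑ j ∈ B, (K1 - Real.log 2 * (j + 1)) := by
        rw [hB, Finset.sum_filter, ← Finset.sum_add_distrib, logUp]
        refine Finset.sum_le_sum fun j hj => ?_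
        split_ifs with h
        · have := hlogU j (Finset.mem_filter.2 ⟨hj, h⟩)
          linarith
        · simpa using log_upAmp_le c (j + 1) i
      rw [Finset.sum_sub_distrib, ← Finset.mul_sum] at h1
      simp only [Finset.sum_const, Finset.card_range, nsmul_eq_mul] at h1
      rw [hK, div_mul_eq_mul_div, le_div_iff₀ hl2]
      nlinarith
    have hcard : (B.card : ℝ) * m ^ 2 ≤ (1 + K) * n := by
      have h1 := card_le_add_sum_div B (T := m ^ 2) (by positivity)
      push_cast at h1
      have h2 : (0 : ℝ) < (m : ℝ) ^ 2 := by positivity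
      have h3 := mul_le_mul_of_nonneg_right h1 h2.le
      rw [add_mul, div_mul_cancel₀ _ h2.ne'] at h3
      nlinarith
    have hcost : (B.card : ℝ) * (K3 * m) ≤ ε / 2 * n := by
      have h1 : 2 * K3 * (1 + K) ≤ ε * m := by
        rw [mul_comm ε, ← div_le_iff₀ hε]; linarith
      have h2 : (0 : ℝ) ≤ n := Nat.cast_nonneg n
      have h3 : (B.card : ℝ) * (K3 * m) * m ≤ ε / 2 * n * m := by
        calc (B.card : ℝ) * (K3 * m) * m = K3 * ((B.card : ℝ) * m ^ 2) := by ring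
          _ ≤ K3 * ((1 + K) * n) := by gcongr
          _ = (2 * K3 * (1 + K)) / 2 * n := by ring
          _ ≤ (ε * m) / 2 * n := by gcongr
          _ = ε / 2 * n * m := by ring
      exact le_of_mul_le_mul_right h3 (by linarith)
    have hterm : ∀ j ∈ Finset.range n, Real.log (upAmp c (j + 1) i) - ε / 2 -
        (if upAmp c (j + 1) i * τ < 2 * Real.pi / 2 ^ (j + 1) then K3 * m else 0) ≤
          Real.log (l j) := by
      intro j hj
      simp only [hl]
      split_ifs with h
      · have h1 := hlogU j (Finset.mem_filter.2 ⟨hj, h⟩)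
        have h2 : Real.log (2 * (η / 2 ^ (j + 1))) = Real.log 2 - (2 * m + 3) * Real.log 2
            - (j + 1) * Real.log 2 := by
          rw [Real.log_mul (by norm_num) (by positivity), Real.log_div hη0.ne' (by positivity), hη,
            one_div, Real.log_inv, Real.log_pow, Real.log_pow]
          push_cast; ring
        have h3 : K1 = Real.log 2 + Real.log (Real.pi / τ) := by
          rw [hK1, ← Real.log_mul (by norm_num) (by positivity)]; congr 1; ring
        have h4 := Real.log_pos hπτ
        rw [h2]
        nlinarith
      · rw [Real.log_mul (hU j).ne' (Real.exp_pos _).ne', Real.log_exp]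
        linarith
    have hsum := Finset.sum_le_sum hterm
    rw [Finset.sum_sub_distrib, Finset.sum_sub_distrib, ← Finset.sum_filter] at hsum
    simp only [Finset.sum_const, Finset.card_range, nsmul_eq_mul] at hsum
    rw [← hB] at hsum
    change logUp c n i - _ - _ ≤ _ at hsum
    linarith
  · intro j hj x hx hZ
    have h1 := hZ _ (Finset.mem_image_of_mem _ (Finset.mem_range.2 hj))
    simp only [hl]
    split_ifs with h
    · rw [← nsmul_sub] at h1
      have h2 := h1.trans (norm_pow_two_nsmul_le _ _)
      rw [← hη, ← div_le_iff₀' (by positivity)] at h2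
      linarith [two_mul_norm_le_amp c x]
    · have h2 := upAmp_le_amp_add c hx i
      rw [sub_self, abs_zero, zero_add] at h2
      have h3 := mul_le_mul_of_nonneg_left (exp_neg_two_mul_le hτ0.le hτ1) (hU j).le
      linarith

/-! ### Lower bound for the mass of dyadic arcs -/

lemma IsGMeasure.prod_mul_le_real_arc {c : Torus} {μ : Measure Torus} (hμ : IsGMeasure c μ) {n : ℕ}
    {i : ℤ} {l : ℕ → ℝ} (hl : ∀ j, 0 < l j) {G : Set Torus} (hG : MeasurableSet G)
    (h : ∀ j < n, ∀ x ∈ arc (j + 1) i, 2 ^ (j + 1) • x ∈ G → l j ≤ amp c x) :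
    Real.exp (2 * ∑ j ∈ Finset.range n, Real.log (l j)) * μ.real (arc 0 i ∩ G) ≤
      μ.real (arc n i ∩ (fun x => 2 ^ n • x) ⁻¹' G) := by
  have hm : ∀ n : ℕ, Measurable fun x : Torus => 2 ^ n • x := fun n =>
    (continuous_nsmul _).measurable
  induction n with
  | zero => simp
  | succ n ih =>
    have ih := ih fun j hj => h j (by omega)
    have e : (fun y : Torus => y + y) ⁻¹' ((fun x => 2 ^ n • x) ⁻¹' G) =
        (fun x => 2 ^ (n + 1) • x) ⁻¹' G := by
      ext y
      simp only [mem_preimage]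
      rw [add_comm n 1, nsmul_two_pow_add, pow_one, two_nsmul]
    have h1 := hμ.mul_real_le_arc_succ n i (hl n).le (hm n hG) (fun y hy hyB =>
      h n (by omega) y hy (by
        rw [add_comm n 1, nsmul_two_pow_add, pow_one, two_nsmul]; exact hyB))
    rw [e] at h1
    refine le_trans ?_ h1
    rw [Finset.sum_range_succ, mul_add, Real.exp_add, mul_comm (Real.exp _), mul_assoc,
      two_mul (Real.log _), Real.exp_add, Real.exp_log (hl n), sq]
    exact mul_le_mul_of_nonneg_left ih (mul_pos (hl n) (hl n)).le

lemma arc_zero (i : ℤ) : arc 0 i = univ := by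
  refine eq_univ_of_forall fun x => ?_
  obtain ⟨j, hj⟩ := exists_mem_arc 0 x
  rwa [arc_congr (j := i) (by simpa using Int.modEq_one)] at hj

lemma IsGMeasure.eventually_le_real_arc {c : Torus} (hc : c ≠ 0) {μ : Measure Torus}
    (hμ : IsGMeasure c μ) (h0 : μ {0} = 0) {A ε : ℝ} (hA : 0 ≤ A) (hε : 0 < ε) :
    ∀ᶠ n : ℕ in atTop, ∀ i, -A * n ≤ logUp c n i →
      Real.exp (2 * logUp c n i - ε * n) ≤ μ.real (arc n i) := by
  have := hμ.1
  obtain ⟨κ, C, hκ0, hκ1, hC, hball⟩ := hμ.exists_real_closedBall_le hc h0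
  have hlim : Tendsto (fun m : ℕ => ((m : ℝ) + 1) ^ 4 * κ ^ m) atTop (𝓝 0) := by
    have h1 := (tendsto_pow_const_mul_const_pow_of_lt_one 4 hκ0.le hκ1).comp (tendsto_add_atTop_nat 1)
    have h2 := h1.mul_const κ⁻¹
    rw [zero_mul] at h2
    refine h2.congr fun m => ?_
    simp only [Function.comp_apply, pow_succ κ]
    push_cast
    field_simp
  have hsmall : ∀ᶠ n : ℕ in atTop, ((root4 n : ℝ) + 1) ^ 4 * κ ^ root4 n < 1 / (2 * C) :=
    (hlim.comp tendsto_root4).eventually_lt_const (by positivity)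
  have hlog : ∀ᶠ n : ℕ in atTop, Real.log 2 ≤ ε / 2 * n :=
    (tendsto_natCast_atTop_atTop.const_mul_atTop (half_pos hε)).eventually_ge_atTop _
  filter_upwards [eventually_distorted c hA (show 0 < ε / 4 by positivity), hsmall, hlog]
    with n hn hs hlog i hi
  obtain ⟨Z, hZ, l, hl, hsum, hlamp⟩ := hn i hi
  set m := root4 n
  set G : Set Torus := (⋃ z ∈ Z, Metric.closedBall z (1 / 2 ^ (2 * m + 3)))ᶜ with hGdef
  have hGm : MeasurableSet G :=
    (Finset.measurableSet_biUnion _ fun z _ => Metric.isClosed_closedBall.measurableSet).compl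
  have hGc : μ.real Gᶜ ≤ 1 / 2 := by
    rw [hGdef, compl_compl]
    have h1 := (measureReal_biUnion_finset_le (μ := μ) Z
      fun z => Metric.closedBall z (1 / 2 ^ (2 * m + 3))).trans
      (Finset.sum_le_sum fun z _ => hball m z)
    rw [Finset.sum_const, nsmul_eq_mul] at h1
    have h2 : (Z.card : ℝ) ≤ ((m : ℝ) + 1) ^ 4 := by
      have := hZ.trans (lt_root4_succ_pow n).le
      exact_mod_cast this
    refine h1.trans ?_
    calc (Z.card : ℝ) * (C * κ ^ m) ≤ ((m : ℝ) + 1) ^ 4 * (C * κ ^ m) := by gcongr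
      _ = C * (((m : ℝ) + 1) ^ 4 * κ ^ m) := by ring
      _ ≤ C * (1 / (2 * C)) := by gcongr
      _ = 1 / 2 := by field_simp
  have hG2 : 1 / 2 ≤ μ.real G := by
    have := probReal_add_probReal_compl (μ := μ) hGm
    linarith
  have hmain := hμ.prod_mul_le_real_arc (n := n) (i := i) hl hGm (fun j hj x hx hxG =>
    hlamp j hj x hx fun z hz => by
      by_contra hlt
      push Not at hlt
      refine hxG (mem_biUnion hz ?_)
      rw [Metric.mem_closedBall, dist_eq_norm]
      exact hlt.le)
  rw [arc_zero, univ_inter] at hmain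
  refine le_trans ?_ (hmain.trans (measureReal_mono inter_subset_left))
  calc Real.exp (2 * logUp c n i - ε * n)
      ≤ Real.exp (2 * ∑ j ∈ Finset.range n, Real.log (l j) - Real.log 2) := by
        apply Real.exp_le_exp.2; linarith
    _ = Real.exp (2 * ∑ j ∈ Finset.range n, Real.log (l j)) * (1 / 2) := by
        rw [Real.exp_sub, Real.exp_log two_pos]; ring
    _ ≤ _ := by gcongr

/-! ### The level sets of Birkhoff averages -/

/-- The points for which the exponential growth rate of the product of the amplitudes is `b`. -/
def rateSet (c : Torus) (b : ℝ) : Set Torus :=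
  {x | (∀ k, 0 < amp c (2 ^ k • x)) ∧ Tendsto (fun n : ℕ => logAmp c n x / n) atTop (𝓝 b)}

lemma psiSum_eq_bot {c x : Torus} {k n : ℕ} (hk : amp c (2 ^ k • x) = 0) (hkn : k < n) :
    psiSum c n x = ⊥ := by
  have h1 : psi c (dbl^[k] x) = ⊥ := by
    rw [dbl_iterate]; exact if_pos hk
  rw [psiSum, ← Finset.add_sum_erase _ _ (Finset.mem_range.2 hkn), h1, EReal.bot_add]

lemma psiSum_eq_coe {c x : Torus} (hx : ∀ k, 0 < amp c (2 ^ k • x)) (n : ℕ) :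
    psiSum c n x = ((2 * logAmp c n x : ℝ) : EReal) := by
  have h1 : ∀ k, psi c (dbl^[k] x) = ((2 * Real.log (amp c (2 ^ k • x)) : ℝ) : EReal) := fun k => by
    rw [dbl_iterate]; exact if_neg (hx k).ne'
  rw [psiSum, logAmp, Finset.mul_sum]
  simp only [h1]
  induction n with
  | zero => simp
  | succ n ih => rw [Finset.sum_range_succ, Finset.sum_range_succ, ih, EReal.coe_add]

lemma tendsto_psiSum_iff (c x : Torus) (a : ℝ) :
    Tendsto (fun n : ℕ => (((n : ℝ)⁻¹ : ℝ) : EReal) * psiSum c n x) atTop (𝓝 ((a : ℝ) : EReal)) ↔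
      x ∈ rateSet c (a / 2) := by
  by_cases hx : ∀ k, 0 < amp c (2 ^ k • x)
  · simp only [psiSum_eq_coe hx, ← EReal.coe_mul, EReal.tendsto_coe, rateSet, mem_ofPred_eq, hx,
      implies_true, true_and]
    constructor
    · intro h
      refine (h.div_const 2).congr fun n => ?_
      ring
    · intro h
      have h2 := h.const_mul 2
      rw [mul_div_cancel₀ a two_ne_zero] at h2
      refine h2.congr fun n => ?_
      ring
  · refine iff_of_false (fun h => ?_) fun h => hx h.1
    push Not at hx
    obtain ⟨k, hk⟩ := hx
    have hk := le_antisymm hk (amp_nonneg _ _)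
    have h2 : Tendsto (fun n : ℕ => (((n : ℝ)⁻¹ : ℝ) : EReal) * psiSum c n x) atTop (𝓝 ⊥) := by
      refine tendsto_const_nhds.congr' ?_
      filter_upwards [eventually_gt_atTop k] with n hn
      rw [psiSum_eq_bot hk hn, EReal.coe_mul_bot_of_pos]
      have : 0 < n := by omega
      positivity
    exact EReal.coe_ne_bot a (tendsto_nhds_unique h h2)

lemma logUp_le_logAmp_add {c : Torus} {q p : ℕ} {i i' : ℤ} {x : Torus} (hx : x ∈ arc (q + p) i)
    (hi : |(i : ℝ) - i'| ≤ 1) (hamp : ∀ k < p, 1 / 2 ^ q ≤ amp c (2 ^ k • x)) :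
    logUp c (q + p) i' ≤ 2 * q + logAmp c p x + 3 * Real.pi := by
  have hπ := Real.pi_pos
  rw [logUp, Finset.sum_range_add]
  have h1 : ∑ j ∈ Finset.range q, Real.log (upAmp c (j + 1) i') ≤ 2 * q := by
    refine (Finset.sum_le_sum fun j _ => log_upAmp_le c (j + 1) i').trans ?_
    simp [mul_comm]
  have h2 : ∀ j ∈ Finset.range p, Real.log (upAmp c (q + j + 1) i') ≤
      Real.log (amp c (2 ^ (p - 1 - j) • x)) + 3 * Real.pi / 2 * (1 / 2) ^ j := by
    intro j hj
    rw [Finset.mem_range] at hj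
    have hmem := nsmul_sub_mem_arc hx (j := q + j) (by omega)
    rw [show q + p - 1 - (q + j) = p - 1 - j by omega] at hmem
    have ha := hamp (p - 1 - j) (by omega)
    set a := amp c (2 ^ (p - 1 - j) • x)
    have ha0 : 0 < a := lt_of_lt_of_le (by positivity) ha
    have h3 : upAmp c (q + j + 1) i' ≤ a * (1 + 3 * Real.pi / 2 * (1 / 2) ^ j) := by
      refine (upAmp_le_amp_add c hmem i').trans ?_
      rw [mul_add, mul_one]
      refine add_le_add le_rfl ?_
      calc (|(i : ℝ) - i'| + 2) * Real.pi / 2 ^ (q + j + 1)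
          ≤ 3 * Real.pi / 2 ^ (q + j + 1) := by gcongr; linarith
        _ = 1 / 2 ^ q * (3 * Real.pi / 2 * (1 / 2) ^ j) := by
          rw [pow_succ, pow_add, one_div_pow]; field_simp
        _ ≤ _ := by gcongr
    refine (Real.log_le_log (upAmp_pos _ _ _) h3).trans ?_
    rw [Real.log_mul ha0.ne' (by positivity)]
    refine add_le_add le_rfl ?_
    have := Real.log_le_sub_one_of_pos (show 0 < 1 + 3 * Real.pi / 2 * (1 / 2) ^ j by positivity)
    linarith
  have h3 := Finset.sum_le_sum h2
  rw [Finset.sum_add_distrib, ← logAmp_eq_sum_reflect, ← Finset.mul_sum] at h3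
  have h4 : ∑ j ∈ Finset.range p, (1 / 2 : ℝ) ^ j ≤ 2 := by
    have := Summable.sum_le_tsum (Finset.range p) (fun j _ => by positivity) summable_geometric_two
    rwa [tsum_geometric_two] at this
  have h5 := mul_le_mul_of_nonneg_left h4 (show 0 ≤ 3 * Real.pi / 2 by positivity)
  linarith

lemma rateSet.exists_abs_le {c x : Torus} {b : ℝ} (hx : x ∈ rateSet c b) {δ : ℝ} (hδ : 0 < δ) :
    ∃ C : ℝ, 0 ≤ C ∧ ∀ n : ℕ, |logAmp c n x - b * n| ≤ δ * n + C := by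
  obtain ⟨N, hN⟩ := eventually_atTop.1 ((Metric.tendsto_nhds.1 hx.2) δ hδ)
  refine ⟨∑ n ∈ Finset.range (N + 1), |logAmp c n x - b * n|,
    Finset.sum_nonneg fun _ _ => abs_nonneg _, fun n => ?_⟩
  rcases lt_or_ge n (N + 1) with hn | hn
  · have := Finset.single_le_sum (f := fun n : ℕ => |logAmp c n x - b * n|)
      (fun _ _ => abs_nonneg _) (Finset.mem_range.2 hn)
    have h2 : 0 ≤ δ * n := by positivity
    linarith
  · have h1 := hN n (by omega)
    have hn0 : (0 : ℝ) < n := by exact_mod_cast (by omega : 0 < n)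
    rw [Real.dist_eq] at h1
    have h2 : logAmp c n x - b * n = (logAmp c n x / n - b) * n := by field_simp
    have h3 : |logAmp c n x - b * n| ≤ δ * n := by
      rw [h2, abs_mul, abs_of_pos hn0]
      gcongr
    exact h3.trans (le_add_of_nonneg_right (Finset.sum_nonneg fun _ _ => abs_nonneg _))

lemma rateSet.eventually_logUp_le {c x : Torus} {b : ℝ} (hx : x ∈ rateSet c b) {ε : ℝ}
    (hε : 0 < ε) : ∀ᶠ n : ℕ in atTop, ∀ i i' : ℤ, x ∈ arc n i → |(i : ℝ) - i'| ≤ 1 →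
      logUp c n i' ≤ (b + ε) * n := by
  set D := 6 * (2 + |b|) + 1 with hD
  have hDp : 0 < D := by positivity
  obtain ⟨δ, hδ, hδ1, hδD⟩ : ∃ δ : ℝ, 0 < δ ∧ δ ≤ 1 / 12 ∧ D * δ ≤ ε / 2 :=
    ⟨min (1 / 12) (ε / (2 * D)), by positivity, min_le_left _ _, by
      have := mul_le_mul_of_nonneg_left (min_le_right (1 / 12) (ε / (2 * D))) hDp.le
      refine this.trans (le_of_eq ?_)
      field_simp⟩
  obtain ⟨C, hC0, hC⟩ := rateSet.exists_abs_le hx hδ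
  have hb0 := abs_nonneg b
  have hbig : ∀ᶠ n : ℕ in atTop, |b| + δ + 2 * C ≤ δ * n :=
    (tendsto_natCast_atTop_atTop.const_mul_atTop hδ).eventually_ge_atTop _
  have hbig2 : ∀ᶠ n : ℕ in atTop, 2 + |b| + C + 3 * Real.pi ≤ ε / 2 * n :=
    (tendsto_natCast_atTop_atTop.const_mul_atTop (half_pos hε)).eventually_ge_atTop _
  have hbig3 : ∀ᶠ n : ℕ in atTop, (2 : ℝ) ≤ n := tendsto_natCast_atTop_atTop.eventually_ge_atTop _
  filter_upwards [hbig, hbig2, hbig3] with n h1 h2 h3' i i' hi hii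
  set q := ⌈6 * δ * n⌉₊ with hq
  have hq1 : 6 * δ * n ≤ q := Nat.le_ceil _
  have hq2 : (q : ℝ) < 6 * δ * n + 1 := Nat.ceil_lt_add_one (by positivity)
  have hqn : q ≤ n := by
    have : (q : ℝ) ≤ n := by nlinarith
    exact_mod_cast this
  clear_value q
  obtain ⟨p, rfl⟩ := Nat.exists_eq_add_of_le hqn
  have hpn : (p : ℝ) ≤ (q + p : ℕ) := by push_cast; linarith [Nat.cast_nonneg (α := ℝ) q]
  have hamp : ∀ k < p, 1 / 2 ^ q ≤ amp c (2 ^ k • x) := fun k hk => by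
    have h4 := abs_le.1 (hC k)
    have h5 := abs_le.1 (hC (k + 1))
    have h6 : logAmp c (k + 1) x = logAmp c k x + Real.log (amp c (2 ^ k • x)) := by
      rw [logAmp, Finset.sum_range_succ]; rfl
    have hkn : (k : ℝ) ≤ (q + p : ℕ) := by exact_mod_cast (by omega : k ≤ q + p)
    push_cast at h5
    have h7 : -(3 * δ * (q + p : ℕ)) ≤ Real.log (amp c (2 ^ k • x)) := by
      have := neg_abs_le b
      nlinarith
    have h8 : -(q * Real.log 2) ≤ Real.log (amp c (2 ^ k • x)) := by
      refine le_trans ?_ h7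
      have : (0.5 : ℝ) < Real.log 2 := by have := Real.log_two_gt_d9; norm_num at this ⊢; linarith
      have hq0 : (0 : ℝ) ≤ q := Nat.cast_nonneg q
      nlinarith
    rw [Real.le_log_iff_exp_le (hx.1 k), ← Real.log_pow, Real.exp_neg,
      Real.exp_log (by positivity)] at h8
    rwa [one_div]
  have h4 := logUp_le_logAmp_add hi hii hamp
  have h5 := (abs_le.1 (hC p)).2
  have h6 : b * p ≤ b * (q + p : ℕ) + |b| * q := by
    push_cast
    have := neg_abs_le b
    have hq0 : (0 : ℝ) ≤ q := Nat.cast_nonneg q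
    nlinarith
  have h7 : D * δ * (q + p : ℕ) ≤ ε / 2 * (q + p : ℕ) := by gcongr
  have h8 : (2 + |b|) * q ≤ (2 + |b|) * (6 * δ * (q + p : ℕ) + 1) := by gcongr
  have h9 : δ * p ≤ δ * (q + p : ℕ) := by gcongr
  rw [hD] at h7
  linarith

lemma rateSet.eventually_le_logUp {c x : Torus} {b : ℝ} (hx : x ∈ rateSet c b) {ε : ℝ}
    (hε : 0 < ε) : ∀ᶠ n : ℕ in atTop, ∀ i : ℤ, x ∈ arc n i → (b - ε) * n ≤ logUp c n i := by
  filter_upwards [hx.2.eventually_const_lt (show b - ε < b by linarith), eventually_gt_atTop 0]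
    with n hn h0 i hi
  have h0' : (0 : ℝ) < n := by exact_mod_cast h0
  rw [lt_div_iff₀ h0'] at hn
  exact hn.le.trans (logAmp_le_logUp hi fun k _ => hx.1 k)

/-! ### Local dimensions along dyadic radii -/

lemma exists_wordVal_le (n : ℕ) {t : ℝ} (h0 : 0 ≤ t) (h1 : t < 1) :
    ∃ ω : Fin n → Bool, wordVal n ω ≤ t ∧ t < wordVal n ω + 1 / 2 ^ n := by
  induction n with
  | zero => exact ⟨fun _ => false, by simpa [wordVal] using h0, by simpa [wordVal] using h1⟩
  | succ n ih =>
    obtain ⟨ω, h2, h3⟩ := ih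
    have hsnoc : ∀ b : Bool, wordVal (n + 1) (Fin.snoc (α := fun _ => Bool) ω b) =
        wordVal n ω + (if b then 1 else 0) / 2 ^ (n + 1) := fun b => by
      simp [wordVal, Fin.sum_univ_castSucc]
    have h4 : (1 : ℝ) / 2 ^ n = 1 / 2 ^ (n + 1) + 1 / 2 ^ (n + 1) := by
      rw [pow_succ]; field_simp; norm_num
    rcases lt_or_ge t (wordVal n ω + 1 / 2 ^ (n + 1)) with h | h
    · exact ⟨_, by rw [hsnoc false]; simpa using h2, by rw [hsnoc false]; simpa using h⟩
    · refine ⟨_, by rw [hsnoc true]; simpa using h, ?_⟩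
      rw [hsnoc true]
      simp only [if_true]
      linarith

lemma exists_mem_cyl (n : ℕ) (x : Torus) :
    ∃ ω : Fin n → Bool, x ∈ cyl n ω ∧ cyl n ω ⊆ Metric.closedBall x (1 / 2 ^ n) := by
  have hx : ((AddCircle.equivIco 1 0 x : ℝ) : Torus) = x := (AddCircle.equivIco 1 0).symm_apply_apply x
  have hm : 0 ≤ (AddCircle.equivIco 1 0 x : ℝ) ∧ (AddCircle.equivIco 1 0 x : ℝ) < 1 := by
    simpa using (AddCircle.equivIco 1 0 x).2
  obtain ⟨ω, h1, h2⟩ := exists_wordVal_le n hm.1 hm.2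
  refine ⟨ω, ⟨_, ⟨h1, h2.le⟩, hx⟩, ?_⟩
  rintro _ ⟨s, hs, rfl⟩
  rw [Metric.mem_closedBall, dist_eq_norm]
  nth_rewrite 1 [← hx]
  dsimp only
  rw [← AddCircle.coe_sub]
  refine (norm_coe_le_abs _).trans (abs_le.2 ⟨?_, ?_⟩) <;> linarith [hs.1, hs.2]

lemma real_closedBall_pos {μ : Measure Torus} [IsFiniteMeasure μ]
    (hpos : ∀ (n : ℕ) (ω : Fin n → Bool), 0 < μ (cyl n ω)) (x : Torus) (n : ℕ) :
    0 < μ.real (Metric.closedBall x (1 / 2 ^ n)) := by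
  obtain ⟨ω, -, h⟩ := exists_mem_cyl n x
  exact ENNReal.toReal_pos ((hpos n ω).trans_le (measure_mono h)).ne' (measure_ne_top _ _)

lemma hasLocDim_iff {μ : Measure Torus} [IsProbabilityMeasure μ]
    (hpos : ∀ (n : ℕ) (ω : Fin n → Bool), 0 < μ (cyl n ω)) (x : Torus) (α : ℝ) :
    HasLocDim μ x α ↔
      Tendsto (fun n : ℕ => Real.log (μ.real (Metric.closedBall x (1 / 2 ^ n))) / n) atTop
        (𝓝 (-α * Real.log 2)) := by
  have hl2 : 0 < Real.log 2 := Real.log_pos one_lt_two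
  constructor
  · intro h
    have h1 : Tendsto (fun n : ℕ => (1 : ℝ) / 2 ^ n) atTop (𝓝[>] 0) := by
      refine tendsto_nhdsWithin_iff.2 ⟨?_, Eventually.of_forall fun n => ?_⟩
      · simpa [one_div_pow] using
          tendsto_pow_atTop_nhds_zero_of_lt_one (r := (1 / 2 : ℝ)) (by norm_num) (by norm_num)
      · rw [mem_Ioi]; positivity
    have h2 := (h.comp h1).mul_const (-Real.log 2)
    rw [show α * -Real.log 2 = -α * Real.log 2 by ring] at h2
    refine h2.congr fun n => ?_
    simp only [Function.comp_apply, one_div, Real.log_inv, Real.log_pow, Measure.real]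
    field_simp
  · intro h
    set f : ℕ → ℝ := fun n => Real.log (μ.real (Metric.closedBall x (1 / 2 ^ n))) with hf
    have hf0 : ∀ n, f n ≤ 0 := fun n => Real.log_nonpos measureReal_nonneg measureReal_le_one
    have hL : Tendsto (fun r : ℝ => -Real.log r / Real.log 2) (𝓝[>] 0) atTop :=
      (tendsto_neg_atBot_atTop.comp Real.tendsto_log_nhdsGT_zero).atTop_div_const hl2
    have hN := (tendsto_nat_floor_atTop (α := ℝ)).comp hL
    have hlo : Tendsto (fun n : ℕ => -(f n / (((n : ℝ) + 1) * Real.log 2))) atTop (𝓝 α) := by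
      have h2 := (h.mul (tendsto_natCast_div_add_atTop (1 : ℝ))).mul_const (-(Real.log 2)⁻¹)
      rw [show -α * Real.log 2 * 1 * -(Real.log 2)⁻¹ = α by field_simp] at h2
      refine h2.congr' ?_
      filter_upwards [eventually_gt_atTop 0] with n hn
      have : (n : ℝ) ≠ 0 := by positivity
      field_simp
      ring
    have hhi : Tendsto (fun n : ℕ => -(f (n + 1) / ((n : ℝ) * Real.log 2))) atTop (𝓝 α) := by
      have h2 := ((h.comp (tendsto_add_atTop_nat 1)).div
        (tendsto_natCast_div_add_atTop (1 : ℝ)) one_ne_zero).mul_const (-(Real.log 2)⁻¹)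
      rw [show -α * Real.log 2 / 1 * -(Real.log 2)⁻¹ = α by field_simp] at h2
      refine h2.congr' ?_
      filter_upwards [eventually_gt_atTop 0] with n hn
      have : (n : ℝ) ≠ 0 := by positivity
      simp only [Pi.div_apply, Function.comp_apply]
      push_cast
      field_simp
      ring
    refine tendsto_of_tendsto_of_tendsto_of_le_of_le' (hlo.comp hN) (hhi.comp hN) ?_ ?_
    · filter_upwards [hL.eventually_ge_atTop 1, self_mem_nhdsWithin] with r hr hr0
      rw [mem_Ioi] at hr0
      have h1 := Nat.floor_le (zero_le_one.trans hr)
      have h2 := Nat.lt_floor_add_one (-Real.log r / Real.log 2)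
      simp only [Function.comp_apply]
      set n := ⌊-Real.log r / Real.log 2⌋₊
      have hlr : Real.log r < 0 := by
        rw [le_div_iff₀ hl2] at hr; linarith
      rw [div_lt_iff₀ hl2] at h2
      rw [le_div_iff₀ hl2] at h1
      have hball : Real.log (μ (Metric.closedBall x r)).toReal ≤ f n := by
        have hrn : r ≤ 1 / 2 ^ n := by
          rw [← Real.log_le_log_iff hr0 (by positivity), one_div, Real.log_inv, Real.log_pow]
          linarith
        refine Real.log_le_log ?_ (measureReal_mono (Metric.closedBall_subset_closedBall hrn))
        refine (real_closedBall_pos hpos x (n + 1)).trans_le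
          (measureReal_mono (Metric.closedBall_subset_closedBall ?_))
        rw [← Real.log_le_log_iff (by positivity) hr0, one_div, Real.log_inv, Real.log_pow]
        push_cast; linarith
      rw [← neg_div_neg_eq (Real.log (μ (Metric.closedBall x r)).toReal), ← neg_div]
      have h5 : 0 ≤ -f n := by linarith [hf0 n]
      exact div_le_div₀ (by linarith) (by linarith) (by linarith) h2.le
    · filter_upwards [hL.eventually_ge_atTop 1, self_mem_nhdsWithin] with r hr hr0
      rw [mem_Ioi] at hr0
      have h1 := Nat.floor_le (zero_le_one.trans hr)
      have h2 := Nat.lt_floor_add_one (-Real.log r / Real.log 2)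
      have h3 : 0 < ⌊-Real.log r / Real.log 2⌋₊ := Nat.floor_pos.2 hr
      simp only [Function.comp_apply]
      set n := ⌊-Real.log r / Real.log 2⌋₊
      have h3' : (0 : ℝ) < n := by exact_mod_cast h3
      have hlr : Real.log r < 0 := by
        rw [le_div_iff₀ hl2] at hr; linarith
      rw [div_lt_iff₀ hl2] at h2
      rw [le_div_iff₀ hl2] at h1
      have hball : f (n + 1) ≤ Real.log (μ (Metric.closedBall x r)).toReal := by
        refine Real.log_le_log (real_closedBall_pos hpos x (n + 1))
          (measureReal_mono (Metric.closedBall_subset_closedBall ?_))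
        rw [← Real.log_le_log_iff (by positivity) hr0, one_div, Real.log_inv, Real.log_pow]
        push_cast; linarith
      rw [← neg_div_neg_eq (Real.log (μ (Metric.closedBall x r)).toReal), ← neg_div]
      exact div_le_div₀ (by linarith [hf0 (n + 1)]) (by linarith) (by positivity) h1

/-- Points with a given exponential growth rate have the corresponding local dimension. -/
lemma IsGMeasure.hasLocDim_of_mem_rateSet {c : Torus} (hc : c ≠ 0) {μ : Measure Torus}
    (hμ : IsGMeasure c μ) (h0 : μ {0} = 0)
    (hpos : ∀ (n : ℕ) (ω : Fin n → Bool), 0 < μ (cyl n ω)) {α : ℝ} {x : Torus}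
    (hx : x ∈ rateSet c (-α * Real.log 2 / 2)) : HasLocDim μ x α := by
  have := hμ.1
  rw [hasLocDim_iff hpos]
  set b := -α * Real.log 2 / 2 with hb
  rw [show -α * Real.log 2 = 2 * b by rw [hb]; ring]
  refine Metric.tendsto_nhds.2 fun ε hε => ?_
  have hε4 : 0 < ε / 8 := by positivity
  have hlog : ∀ᶠ n : ℕ in atTop, Real.log 3 ≤ ε / 8 * n :=
    (tendsto_natCast_atTop_atTop.const_mul_atTop hε4).eventually_ge_atTop _
  filter_upwards [rateSet.eventually_logUp_le hx hε4, rateSet.eventually_le_logUp hx hε4,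
    hμ.eventually_le_real_arc hc h0 (A := |b| + ε / 8) (by positivity) hε4, hlog,
    eventually_gt_atTop 0] with n hup hlo hmass hlog hn
  have hn' : (0 : ℝ) < n := by exact_mod_cast hn
  obtain ⟨i, hi⟩ := exists_mem_arc n x
  have hB0 := real_closedBall_pos hpos x n
  have h1 : (2 * b - ε / 2) * n ≤ Real.log (μ.real (Metric.closedBall x (1 / 2 ^ n))) := by
    rw [Real.le_log_iff_exp_le hB0]
    refine le_trans ?_ (measureReal_mono (arc_subset_closedBall hi))
    have h2 := hlo i hi
    refine le_trans (Real.exp_le_exp.2 ?_) (hmass i ?_)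
    · nlinarith
    · have := neg_abs_le b
      nlinarith
  have h2 : Real.log (μ.real (Metric.closedBall x (1 / 2 ^ n))) ≤ (2 * b + ε / 2) * n := by
    have harc : ∀ i' : ℤ, |(i : ℝ) - i'| ≤ 1 →
        μ.real (arc n i') ≤ Real.exp ((2 * b + ε / 4) * n) := fun i' hi' =>
      (hμ.real_arc_le h0 n i').trans (Real.exp_le_exp.2 (by nlinarith [hup i i' hi hi']))
    have h3 := (measureReal_mono (μ := μ) (closedBall_subset_arcs hi)).trans
      ((measureReal_union_le _ _).trans (add_le_add (measureReal_union_le _ _) le_rfl))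
    have h4 := harc (i - 1) (by push_cast; simp)
    have h5 := harc i (by simp)
    have h6 := harc (i + 1) (by push_cast; simp)
    refine (Real.log_le_log hB0 (h3.trans (add_le_add (add_le_add h4 h5) h6))).trans ?_
    rw [← two_mul, ← add_one_mul, show (2 : ℝ) + 1 = 3 by norm_num,
      Real.log_mul (by norm_num) (Real.exp_pos _).ne', Real.log_exp]
    nlinarith
  rw [Real.dist_eq, abs_lt]
  constructor
  · have : 2 * b - ε / 2 ≤ Real.log (μ.real (Metric.closedBall x (1 / 2 ^ n))) / n := by
      rwa [le_div_iff₀ hn']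
    linarith
  · have : Real.log (μ.real (Metric.closedBall x (1 / 2 ^ n))) / n ≤ 2 * b + ε / 2 := by
      rwa [div_le_iff₀ hn']
    linarith

/-! ### Counting dyadic arcs -/

open Classical in
/-- The dyadic arcs of level `n` on which the growth rate of the product of the amplitudes is
close to `a / 2`. -/
def typicalArcs (c : Torus) (a ε : ℝ) (n : ℕ) : Finset ℤ :=
  (Finset.Ico (0 : ℤ) (2 ^ n)).filter fun i => |2 * logUp c n i - a * n| ≤ ε * n

lemma IsGMeasure.eventually_exists_typicalArcs {c : Torus} (hc : c ≠ 0) {μ : Measure Torus}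
    (hμ : IsGMeasure c μ) (h0 : μ {0} = 0)
    (hpos : ∀ (n : ℕ) (ω : Fin n → Bool), 0 < μ (cyl n ω)) {α : ℝ} {ε : ℝ} (hε : 0 < ε)
    {x : Torus} (hx : HasLocDim μ x α) :
    ∀ᶠ n : ℕ in atTop, ∃ i ∈ typicalArcs c (-α * Real.log 2) ε n,
      x ∈ Metric.closedBall (pt n i) (2 / 2 ^ n) := by
  have := hμ.1
  rw [hasLocDim_iff hpos] at hx
  set a := -α * Real.log 2 with ha
  have hε4 : 0 < ε / 4 := by positivity
  have hball : ∀ᶠ n : ℕ in atTop,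
      |Real.log (μ.real (Metric.closedBall x (1 / 2 ^ n))) - a * n| ≤ ε / 4 * n := by
    filter_upwards [Metric.tendsto_nhds.1 hx _ hε4, eventually_gt_atTop 0] with n h1 hn
    have hn' : (0 : ℝ) < n := by exact_mod_cast hn
    rw [Real.dist_eq] at h1
    have h2 : Real.log (μ.real (Metric.closedBall x (1 / 2 ^ n))) - a * n =
      (Real.log (μ.real (Metric.closedBall x (1 / 2 ^ n))) / n - a) * n := by field_simp
    rw [h2, abs_mul, abs_of_pos hn']
    gcongr
  have hlog : ∀ᶠ n : ℕ in atTop, Real.log 3 ≤ ε / 4 * n :=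
    (tendsto_natCast_atTop_atTop.const_mul_atTop hε4).eventually_ge_atTop _
  have hlog2 : ∀ᶠ n : ℕ in atTop, |a| ≤ ε / 4 * n :=
    (tendsto_natCast_atTop_atTop.const_mul_atTop hε4).eventually_ge_atTop _
  filter_upwards [hball, (tendsto_sub_atTop_nat 1).eventually hball, hlog, hlog2,
    hμ.eventually_le_real_arc hc h0 (A := |a| + ε) (by positivity) hε4, eventually_gt_atTop 0]
    with n hb1 hb2 hlog hlog2 hmass hn
  have hn' : (0 : ℝ) < n := by exact_mod_cast hn
  obtain ⟨i, hi⟩ := exists_mem_arc n x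
  have hB0 := real_closedBall_pos hpos x n
  have hB1 := real_closedBall_pos hpos x (n - 1)
  have ha1 := neg_abs_le a
  have ha2 := le_abs_self a
  obtain ⟨i', hi', hB⟩ : ∃ i' : ℤ, |(i : ℝ) - i'| ≤ 1 ∧
      μ.real (Metric.closedBall x (1 / 2 ^ n)) ≤ 3 * μ.real (arc n i') := by
    by_contra! h
    have h3 := (measureReal_mono (μ := μ) (closedBall_subset_arcs hi)).trans
      ((measureReal_union_le _ _).trans (add_le_add (measureReal_union_le _ _) le_rfl))
    linarith [h (i - 1) (by push_cast; simp), h i (by simp), h (i + 1) (by push_cast; simp)]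
  have harc0 : 0 < μ.real (arc n i') := by linarith
  have hlow : (a - ε / 2) * n ≤ 2 * logUp c n i' := by
    have h1 := (abs_le.1 hb1).1
    have h2 := Real.log_le_log hB0 hB
    rw [Real.log_mul (by norm_num) harc0.ne'] at h2
    have h3 := Real.log_le_log harc0 (hμ.real_arc_le h0 n i')
    rw [Real.log_exp] at h3
    linarith
  have hdist : ‖x - pt n i'‖ ≤ 2 / 2 ^ n := (norm_sub_pt_le hi i').trans (by gcongr; linarith)
  have hup : 2 * logUp c n i' ≤ (a + ε) * n := by
    have h1 := hmass i' (by nlinarith)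
    have h2 : arc n i' ⊆ Metric.closedBall x (1 / 2 ^ (n - 1)) := fun y hy => by
      obtain ⟨u, hu0, hu1, rfl⟩ := hi
      obtain ⟨v, hv0, hv1, rfl⟩ := hy
      rw [Metric.mem_closedBall, dist_eq_norm, ← AddCircle.coe_sub]
      refine (norm_coe_le_abs _).trans ?_
      obtain ⟨k, rfl⟩ : ∃ k, n = k + 1 := ⟨n - 1, by omega⟩
      rw [Nat.add_sub_cancel, ← sub_div, abs_div, abs_of_pos (by positivity : (0 : ℝ) < 2 ^ (k + 1)),
        pow_succ, div_le_div_iff₀ (by positivity) (by positivity)]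
      have : |(i' : ℝ) + v - (i + u)| ≤ 2 := by
        have := abs_le.1 hi'
        rw [abs_le]; constructor <;> linarith [this.1, this.2]
      nlinarith [pow_pos (two_pos (α := ℝ)) k]
    have h3 := Real.log_le_log (Real.exp_pos _) (h1.trans (measureReal_mono h2))
    rw [Real.log_exp] at h3
    have h4 := (abs_le.1 hb2).2
    rw [Nat.cast_sub (by omega : 1 ≤ n)] at h4
    push_cast at h4
    nlinarith
  have hmod : i' % 2 ^ n ≡ i' [ZMOD 2 ^ n] := Int.mod_modEq _ _
  refine ⟨i' % 2 ^ n, ?_, ?_⟩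
  · classical
    rw [typicalArcs, Finset.mem_filter, Finset.mem_Ico]
    refine ⟨⟨Int.emod_nonneg _ (by positivity), Int.emod_lt_of_pos _ (by positivity)⟩, ?_⟩
    rw [logUp_congr c hmod, abs_le]
    constructor <;> nlinarith
  · rw [pt_congr hmod, Metric.mem_closedBall, dist_eq_norm]
    exact hdist

lemma IsGMeasure.dimH_le_of_frequently {c : Torus} (hc : c ≠ 0) {μ : Measure Torus}
    (hμ : IsGMeasure c μ) (h0 : μ {0} = 0)
    (hpos : ∀ (n : ℕ) (ω : Fin n → Bool), 0 < μ (cyl n ω)) {α : ℝ} {ε : ℝ} (hε : 0 < ε)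
    {r : NNReal} (h : ∃ᶠ n : ℕ in atTop,
      ((typicalArcs c (-α * Real.log 2) ε n).card : ℝ) ≤ 2 ^ ((r : ℝ) * n)) :
    dimH {x : Torus | HasLocDim μ x α} ≤ r := by
  set W := typicalArcs c (-α * Real.log 2) ε
  set S : ℕ → Set Torus := fun N => {x | ∀ n ≥ N, ∃ i ∈ W n,
    x ∈ Metric.closedBall (pt n i) (2 / 2 ^ n)} with hS
  have hsub : {x : Torus | HasLocDim μ x α} ⊆ ⋃ N, S N := fun x hx => by
    obtain ⟨N, hN⟩ := eventually_atTop.1 (hμ.eventually_exists_typicalArcs hc h0 hpos hε hx)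
    exact mem_iUnion.2 ⟨N, hN⟩
  refine (dimH_mono hsub).trans ?_
  rw [dimH_iUnion]
  refine iSup_le fun N => dimH_le_of_hausdorffMeasure_ne_top (ne_of_lt ?_)
  have hdiam : ∀ n i, Metric.ediam (Metric.closedBall (pt n i) (2 / 2 ^ n)) ≤
      ENNReal.ofReal (4 / 2 ^ n) := fun n i => Metric.ediam_le_of_forall_dist_le fun x hx y hy => by
    have := dist_triangle_right x y (pt n i)
    rw [Metric.mem_closedBall] at hx hy
    have h4 : (4 : ℝ) / 2 ^ n = 2 / 2 ^ n + 2 / 2 ^ n := by ring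
    linarith
  have hlim : Tendsto (fun n : ℕ => ENNReal.ofReal (4 / 2 ^ n)) atTop (𝓝 0) := by
    have h1 : Tendsto (fun n : ℕ => (4 : ℝ) / 2 ^ n) atTop (𝓝 0) := by
      have := (tendsto_pow_atTop_nhds_zero_of_lt_one (r := (1 / 2 : ℝ)) (by norm_num)
        (by norm_num)).const_mul 4
      rw [mul_zero] at this
      refine this.congr fun n => ?_
      rw [one_div_pow]; ring
    simpa using ENNReal.tendsto_ofReal h1
  refine lt_of_le_of_lt (Measure.hausdorffMeasure_le_liminf_sum (ι := fun n => W n) (r : ℝ) (S N)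
    (fun n => ENNReal.ofReal (4 / 2 ^ n)) hlim
    (fun n i => Metric.closedBall (pt n i) (2 / 2 ^ n))
    (Eventually.of_forall fun n i => hdiam n i) ?_) ?_
  · filter_upwards [eventually_ge_atTop N] with n hn x hx
    obtain ⟨i, hi, hxi⟩ := hx n hn
    exact mem_iUnion.2 ⟨⟨i, hi⟩, hxi⟩
  · refine lt_of_le_of_lt (liminf_le_of_frequently_le' (x := ENNReal.ofReal (4 ^ (r : ℝ))) ?_)
      ENNReal.ofReal_lt_top
    refine h.mono fun n hn => ?_
    calc ∑ i : W n, Metric.ediam (Metric.closedBall (pt n i) (2 / 2 ^ n)) ^ (r : ℝ)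
        ≤ ∑ _i : W n, ENNReal.ofReal (4 / 2 ^ n) ^ (r : ℝ) :=
          Finset.sum_le_sum fun i _ => ENNReal.rpow_le_rpow (hdiam n i) r.2
      _ = ENNReal.ofReal ((W n).card * (4 / 2 ^ n) ^ (r : ℝ)) := by
          rw [Finset.sum_const, nsmul_eq_mul, ENNReal.ofReal_rpow_of_nonneg (by positivity) r.coe_nonneg,
            ENNReal.ofReal_mul (by positivity)]
          simp
      _ ≤ _ := by
          refine ENNReal.ofReal_le_ofReal ?_
          rw [Real.div_rpow (by norm_num) (by positivity), ← Real.rpow_natCast,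
            ← Real.rpow_mul (by norm_num), mul_div_assoc', div_le_iff₀ (by positivity),
            mul_comm (n : ℝ), mul_comm ((4 : ℝ) ^ (r : ℝ))]
          gcongr

/-! ### Connecting orbit segments which avoid the singularity -/

lemma norm_half_sub_le (x y : Torus) : 1 / 2 ≤ ‖x - y‖ + ‖x + ((1 / 2 : ℝ) : Torus) - y‖ := by
  have h : ((1 / 2 : ℝ) : Torus) = (x + ((1 / 2 : ℝ) : Torus) - y) - (x - y) := by abel
  calc (1 / 2 : ℝ) = ‖((1 / 2 : ℝ) : Torus)‖ := norm_half.symm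
    _ = ‖(x + ((1 / 2 : ℝ) : Torus) - y) - (x - y)‖ := by rw [← h]
    _ ≤ _ := (norm_sub_le _ _).trans (add_comm _ _).le

lemma exists_two_preimages {c : Torus} {r : ℝ} (hr : 4 * r ≤ ‖c‖) (p : Torus) :
    ∃ q : Bool → Torus, q true ≠ q false ∧ ∀ b, 2 ^ 2 • q b = p ∧ r ≤ ‖q b - sing c‖ ∧
      r ≤ ‖2 • q b - sing c‖ := by
  have hch := norm_le_half c
  obtain ⟨p', hp'⟩ := exists_add_self_eq p
  -- every point has a preimage away from the singularity
  have hgood : ∀ y : Torus, ∃ q : Torus, q + q = y ∧ r ≤ ‖q - sing c‖ := fun y => by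
    obtain ⟨q, hq⟩ := exists_add_self_eq y
    by_cases h : r ≤ ‖q - sing c‖
    · exact ⟨q, hq, h⟩
    · refine ⟨q + ((1 / 2 : ℝ) : Torus), ?_, ?_⟩
      · rw [add_add_add_comm, half_add_half, add_zero, hq]
      · linarith [norm_half_sub_le q (sing c)]
  have hfour : ∀ q o : Torus, q + q = o → o + o = p → 2 ^ 2 • q = p := fun q o h1 h2 => by
    rw [← h2, ← h1]; simp only [← two_nsmul, ← mul_nsmul]; norm_num
  have hp'2 : p' + ((1 / 2 : ℝ) : Torus) + (p' + ((1 / 2 : ℝ) : Torus)) = p := by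
    rw [add_add_add_comm, half_add_half, add_zero, hp']
  -- a preimage of a point which is opposite to a point close to the singularity
  have hopp : ∀ o : Torus, o + o = p → ‖o + ((1 / 2 : ℝ) : Torus) - sing c‖ < r →
      ∃ q : Bool → Torus, q true ≠ q false ∧ ∀ b, 2 ^ 2 • q b = p ∧ r ≤ ‖q b - sing c‖ ∧
      r ≤ ‖2 • q b - sing c‖ := fun o ho hlt => by
    have ho1 : r ≤ ‖o - sing c‖ := by linarith [norm_half_sub_le o (sing c)]
    have hoc : ‖o - c‖ < r := by
      rwa [sing, add_sub_add_right_eq_sub] at hlt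
    have hpre : ∀ q : Torus, q + q = o → r ≤ ‖q - sing c‖ := fun q hq => by
      by_contra! hlt2
      have h1 : o - (c + c) = (q - sing c) + (q - sing c) := by
        have : sing c + sing c = c + c := by
          rw [sing, add_add_add_comm, half_add_half, add_zero]
        rw [← this, ← hq]; abel
      have h2 : c = (o - c) - (o - (c + c)) := by abel
      have h3 : ‖c‖ ≤ ‖o - c‖ + (‖q - sing c‖ + ‖q - sing c‖) := by
        conv_lhs => rw [h2]
        refine (norm_sub_le _ _).trans (add_le_add le_rfl ?_)
        rw [h1]; exact norm_add_le _ _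
      linarith [norm_nonneg (o - c)]
    obtain ⟨q, hq⟩ := exists_add_self_eq o
    have hq2 : q + ((1 / 2 : ℝ) : Torus) + (q + ((1 / 2 : ℝ) : Torus)) = o := by
      rw [add_add_add_comm, half_add_half, add_zero, hq]
    refine ⟨fun b => if b then q else q + ((1 / 2 : ℝ) : Torus), ?_, ?_⟩
    · simpa using two_inv_ne
    · intro b
      cases b
      · simp only [Bool.false_eq_true, if_false, two_nsmul, hq2]
        exact ⟨hfour _ _ hq2 ho, hpre _ hq2, ho1⟩
      · simp only [if_true, two_nsmul, hq]
        exact ⟨hfour _ _ hq ho, hpre _ hq, ho1⟩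
  by_cases h1 : ‖p' - sing c‖ < r
  · refine hopp (p' + ((1 / 2 : ℝ) : Torus)) hp'2 ?_
    rwa [add_assoc, half_add_half, add_zero]
  by_cases h2 : ‖p' + ((1 / 2 : ℝ) : Torus) - sing c‖ < r
  · exact hopp p' hp' h2
  push Not at h1 h2
  obtain ⟨q1, hq1, hq1'⟩ := hgood p'
  obtain ⟨q2, hq2, hq2'⟩ := hgood (p' + ((1 / 2 : ℝ) : Torus))
  refine ⟨fun b => if b then q1 else q2, ?_, fun b => ?_⟩
  · simp only [if_true, Bool.false_eq_true, if_false]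
    rintro rfl
    rw [hq1] at hq2
    exact two_inv_ne (by simpa using hq2)
  · cases b
    · simp only [Bool.false_eq_true, if_false, two_nsmul, hq2]
      exact ⟨hfour _ _ hq2 hp'2, hq2', h2⟩
    · simp only [if_true, two_nsmul, hq1]
      exact ⟨hfour _ _ hq1 hp', hq1', h1⟩

lemma exists_many_preimages {c : Torus} {r : ℝ} (hr : 4 * r ≤ ‖c‖) (m : ℕ) (y : Torus) :
    ∃ P : Finset Torus, P.card = 2 ^ m ∧ ∀ p ∈ P, 2 ^ (2 * m) • p = y ∧
      ∀ k < 2 * m, r ≤ ‖2 ^ k • p - sing c‖ := by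
  classical
  induction m with
  | zero => exact ⟨{y}, by simp, by simp⟩
  | succ m ih =>
    obtain ⟨P, hPc, hP⟩ := ih
    choose f hne hf using exists_two_preimages hr
    have hinj : ∀ p p' b b', f p b = f p' b' → p = p' := fun p p' b b' h => by
      rw [← (hf p b).1, ← (hf p' b').1, h]
    refine ⟨(P.image fun p => f p true) ∪ (P.image fun p => f p false), ?_, ?_⟩
    · rw [Finset.card_union_of_disjoint, Finset.card_image_of_injective,
        Finset.card_image_of_injective, hPc, pow_succ, mul_two]
      · exact fun p p' h => hinj _ _ _ _ h
      · exact fun p p' h => hinj _ _ _ _ h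
      · rw [Finset.disjoint_left]
        intro q h1 h2
        obtain ⟨p, -, rfl⟩ := Finset.mem_image.1 h1
        obtain ⟨p', -, h⟩ := Finset.mem_image.1 h2
        obtain rfl := hinj _ _ _ _ h
        exact hne _ h.symm
    · have key : ∀ p ∈ P, ∀ b, 2 ^ (2 * (m + 1)) • f p b = y ∧
          ∀ k < 2 * (m + 1), r ≤ ‖2 ^ k • f p b - sing c‖ := fun p hp b => by
        refine ⟨?_, fun k hk => ?_⟩
        · rw [show 2 * (m + 1) = 2 + 2 * m by ring, nsmul_two_pow_add, (hf p b).1, (hP p hp).1]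
        · match k with
          | 0 => simpa using (hf p b).2.1
          | 1 => simpa using (hf p b).2.2
          | k + 2 =>
            rw [add_comm k, nsmul_two_pow_add, (hf p b).1]
            exact (hP p hp).2 k (by omega)
      intro q hq
      rcases Finset.mem_union.1 hq with h | h
      · obtain ⟨p, hp, rfl⟩ := Finset.mem_image.1 h; exact key p hp _
      · obtain ⟨p, hp, rfl⟩ := Finset.mem_image.1 h; exact key p hp _

lemma exists_preimage_avoiding {c : Torus} {r : ℝ} (hr : 4 * r ≤ ‖c‖) (m : ℕ) (y : Torus)
    {Z : Finset Torus} (hZ : Z.card < 2 ^ m) :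
    ∃ p : Torus, 2 ^ (2 * m) • p = y ∧ (∀ k < 2 * m, r ≤ ‖2 ^ k • p - sing c‖) ∧
      ∀ z ∈ Z, 1 / 2 ^ (2 * m + 2) ≤ ‖p - z‖ := by
  obtain ⟨P, hPc, hP⟩ := exists_many_preimages hr m y
  by_contra! h
  have h2 : ∀ p ∈ P, ∃ z ∈ Z, ‖p - z‖ < 1 / 2 ^ (2 * m + 2) := fun p hp =>
    h p (hP p hp).1 (hP p hp).2
  choose! g hgZ hg using h2
  obtain ⟨p, hp, p', hp', hne, heq⟩ :=
    Finset.exists_ne_map_eq_of_card_lt_of_maps_to (by rwa [hPc]) hgZ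
  have h3 : ‖p - p'‖ ≤ ‖p - g p‖ + ‖p' - g p'‖ := by
    rw [show p - p' = (p - g p) - (p' - g p') by rw [heq]; abel]
    exact norm_sub_le _ _
  have h4 : 2 ^ (2 * m) * ‖p - p'‖ ≤ 1 / 2 := by
    have h5 := hg p hp
    have h6 := hg p' hp'
    have h7 : (1 : ℝ) / 2 ^ (2 * m + 2) = 1 / 2 ^ (2 * m) / 4 := by rw [pow_add]; field_simp; norm_num
    have h8 : ‖p - p'‖ ≤ 1 / 2 ^ (2 * m) / 2 := by linarith
    calc 2 ^ (2 * m) * ‖p - p'‖ ≤ 2 ^ (2 * m) * (1 / 2 ^ (2 * m) / 2) := by gcongr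
      _ = 1 / 2 := by field_simp
  have h5 := norm_pow_two_nsmul_eq (2 * m) (p - p') h4
  rw [nsmul_sub, (hP p hp).1, (hP p' hp').1, sub_self, norm_zero] at h5
  have h6 : ‖p - p'‖ = 0 := by
    rcases mul_eq_zero.1 h5.symm with h | h
    · exact absurd h (by positivity)
    · exact h
  exact hne (sub_eq_zero.1 (norm_eq_zero.1 h6))

lemma exists_connector {c : Torus} {r : ℝ} (hr : 4 * r ≤ ‖c‖) (m : ℕ)
    {Z : Finset Torus} (hZ : Z.card < 2 ^ m) (y : ℝ) :
    ∃ h : ℤ, 0 ≤ h ∧ h < 2 ^ (2 * m) ∧ ∀ y' : ℝ, |y' - y| ≤ r / 2 →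
      (∀ z ∈ Z, 1 / 2 ^ (2 * m + 3) ≤ ‖((((h : ℝ) + y') / 2 ^ (2 * m) : ℝ) : Torus) - z‖) ∧
      ∀ k < 2 * m, r / 2 ≤ ‖2 ^ k • ((((h : ℝ) + y') / 2 ^ (2 * m) : ℝ) : Torus) - sing c‖ := by
  obtain ⟨p, hp, hpk, hpZ⟩ := exists_preimage_avoiding hr m (y : Torus) hZ
  obtain ⟨t, rfl, -⟩ := exists_lift_abs_eq_norm p
  rw [pow_nsmul_coe, ← sub_eq_zero, ← AddCircle.coe_sub, AddCircle.coe_eq_zero_iff] at hp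
  obtain ⟨k, hk⟩ := hp
  rw [zsmul_one] at hk
  have hpos : (0 : ℤ) < 2 ^ (2 * m) := by positivity
  have hpow : (0 : ℝ) < 2 ^ (2 * m) := by positivity
  set h := k % 2 ^ (2 * m) with hh
  have hch := norm_le_half c
  have hcoe : (t : Torus) = ((((h : ℝ) + y) / 2 ^ (2 * m) : ℝ) : Torus) := by
    have h1 : t = ((h : ℝ) + y) / 2 ^ (2 * m) + ((k / 2 ^ (2 * m) : ℤ) : ℝ) := by
      have h2 : (k : ℝ) = h + 2 ^ (2 * m) * ((k / 2 ^ (2 * m) : ℤ) : ℝ) := by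
        have := Int.emod_add_mul_ediv k (2 ^ (2 * m))
        exact_mod_cast this.symm
      have h3 : t = (k + y) / 2 ^ (2 * m) := by
        rw [hk]; field_simp; ring
      rw [h3, h2]; field_simp; ring
    conv_lhs => rw [h1]
    rw [AddCircle.coe_add, coe_int, add_zero]
  have hdiff : ∀ y' : ℝ, |y' - y| ≤ r / 2 →
      ‖(t : Torus) - ((((h : ℝ) + y') / 2 ^ (2 * m) : ℝ) : Torus)‖ ≤ r / 2 / 2 ^ (2 * m) := by
    intro y' hy'
    rw [hcoe, ← AddCircle.coe_sub]
    refine (norm_coe_le_abs _).trans ?_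
    rw [← sub_div, abs_div, abs_of_pos hpow, add_sub_add_left_eq_sub, abs_sub_comm]
    gcongr
  refine ⟨h, Int.emod_nonneg _ hpos.ne', Int.emod_lt_of_pos _ hpos, fun y' hy' => ⟨?_, ?_⟩⟩
  · intro z hz
    have h1 := hpZ z hz
    have h2 := norm_sub_le_norm_sub_add_norm_sub (t : Torus)
      ((((h : ℝ) + y') / 2 ^ (2 * m) : ℝ) : Torus) z
    have h3 := hdiff y' hy'
    have h4 : (1 : ℝ) / 2 ^ (2 * m + 2) = 1 / 2 ^ (2 * m + 3) + 1 / 2 ^ (2 * m + 3) := by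
      rw [pow_succ _ (2 * m + 2)]; field_simp; norm_num
    have h5 : r / 2 / 2 ^ (2 * m) ≤ 1 / 2 ^ (2 * m + 3) := by
      rw [div_le_div_iff₀ hpow (by positivity), pow_add]
      nlinarith
    linarith
  · intro k hk
    have h1 := hpk k hk
    have h2 := norm_sub_le_norm_sub_add_norm_sub (2 ^ k • (t : Torus))
      (2 ^ k • ((((h : ℝ) + y') / 2 ^ (2 * m) : ℝ) : Torus)) (sing c)
    have h3 := hdiff y' hy'
    rw [← nsmul_sub] at h2
    have h4 := norm_pow_two_nsmul_le k
      ((t : Torus) - ((((h : ℝ) + y') / 2 ^ (2 * m) : ℝ) : Torus))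
    have h5 : (2 : ℝ) ^ k ≤ 2 ^ (2 * m) := pow_le_pow_right₀ one_le_two hk.le
    rw [le_div_iff₀ hpow] at h3
    have h6 := mul_le_mul_of_nonneg_right h5 (norm_nonneg
      ((t : Torus) - ((((h : ℝ) + y') / 2 ^ (2 * m) : ℝ) : Torus)))
    linarith

lemma root4_isLittleO : (fun n : ℕ => (root4 n : ℝ)) =o[atTop] fun n : ℕ => (n : ℝ) := by
  rw [Asymptotics.isLittleO_iff]
  intro δ hδ
  filter_upwards [tendsto_root4.eventually_ge_atTop (⌈1 / δ⌉₊ + 1)] with n hn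
  rw [Real.norm_of_nonneg (by positivity), Real.norm_of_nonneg (by positivity)]
  have h1 : 1 / δ ≤ root4 n := (Nat.le_ceil _).trans (by exact_mod_cast (Nat.le_succ _).trans hn)
  have h2 : (1 : ℝ) ≤ root4 n := by exact_mod_cast (Nat.le_add_left 1 _).trans hn
  have h3 : (root4 n : ℝ) ^ 4 ≤ n := by exact_mod_cast root4_pow_le n
  have h4 : (root4 n : ℝ) * root4 n ≤ (root4 n : ℝ) ^ 4 := by
    rw [← sq]
    exact pow_le_pow_right₀ h2 (by norm_num)
  rw [div_le_iff₀ hδ] at h1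
  nlinarith

lemma eventually_succ_lt_two_pow_root4 : ∀ᶠ n : ℕ in atTop, n + 1 < 2 ^ root4 n := by
  have key : ∀ m : ℕ, 17 ≤ m → (m + 1) ^ 4 < 2 ^ m := by
    intro m hm
    induction m, hm using Nat.le_induction with
    | base => norm_num
    | succ m hm ih =>
      have h : (m + 1 + 1) ^ 4 ≤ 2 * (m + 1) ^ 4 := by
        obtain ⟨p, rfl⟩ := Nat.exists_eq_add_of_le hm
        ring_nf
        nlinarith [Nat.zero_le (p ^ 2), Nat.zero_le (p ^ 3), Nat.zero_le (p ^ 4)]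
      rw [pow_succ 2 m]
      omega
  filter_upwards [tendsto_root4.eventually_ge_atTop 17] with n hn
  exact (Nat.succ_le_of_lt (lt_root4_succ_pow n)).trans_lt (key _ hn)

lemma exists_expansion (L : ℕ → ℕ) (v : ℕ → ℤ) (h0 : ∀ j, 0 ≤ v j)
    (h1 : ∀ j, v j < 2 ^ L j) :
    ∃ y : ℕ → ℝ, (∀ j, y j ∈ Icc (0 : ℝ) 1) ∧ ∀ j, y j = (v j + y (j + 1)) / 2 ^ L j := by
  set D : ℕ → ℕ → ℝ := fun j i => ∏ l ∈ Finset.range i, (1 / 2 ^ L (j + l)) with hD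
  have hDpos : ∀ j i, 0 < D j i := fun j i => Finset.prod_pos fun _ _ => by positivity
  have hDs : ∀ j i, D j (i + 1) = D j i * (1 / 2 ^ L (j + i)) := fun j i =>
    Finset.prod_range_succ _ _
  have hDs' : ∀ j i, D j (i + 1) = D (j + 1) i * (1 / 2 ^ L j) := fun j i => by
    simp only [hD]
    rw [Finset.prod_range_succ']
    simp only [add_zero, add_assoc, add_comm 1]
  have hnn : ∀ j i, 0 ≤ (v (j + i) : ℝ) * D j (i + 1) := fun j i =>
    mul_nonneg (by exact_mod_cast h0 _) (hDpos _ _).le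
  have hps : ∀ j n, ∑ i ∈ Finset.range n, (v (j + i) : ℝ) * D j (i + 1) ≤ 1 := by
    intro j n
    suffices h : ∑ i ∈ Finset.range n, (v (j + i) : ℝ) * D j (i + 1) ≤ 1 - D j n by
      linarith [hDpos j n]
    induction n with
    | zero => simp [hD]
    | succ n ih =>
      rw [Finset.sum_range_succ]
      have h2 : (v (j + n) : ℝ) ≤ 2 ^ L (j + n) - 1 := by
        have := Int.le_sub_one_of_lt (h1 (j + n))
        exact_mod_cast this
      have h3 : D j n = 2 ^ L (j + n) * D j (n + 1) := by
        rw [hDs]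
        field_simp
      nlinarith [hDpos j (n + 1)]
  have hs : ∀ j, Summable fun i => (v (j + i) : ℝ) * D j (i + 1) := fun j =>
    summable_of_sum_range_le (hnn j) (hps j)
  refine ⟨fun j => ∑' i, (v (j + i) : ℝ) * D j (i + 1), fun j =>
    ⟨tsum_nonneg (hnn j), Real.tsum_le_of_sum_range_le (hnn j) (hps j)⟩, fun j => ?_⟩
  simp only
  rw [(hs j).tsum_eq_zero_add]
  have h2 : ∀ i, (v (j + (i + 1)) : ℝ) * D j (i + 1 + 1)
      = (v (j + 1 + i) : ℝ) * D (j + 1) (i + 1) * (1 / 2 ^ L j) := by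
    intro i
    rw [hDs' j (i + 1), show j + (i + 1) = j + 1 + i by ring]
    ring
  simp only [h2]
  rw [tsum_mul_right, hDs, show D j 0 = 1 by simp [hD]]
  simp only [add_zero]
  ring

lemma exists_bridge {c : Torus} {ε : ℝ} {n : ℕ} {w : ℤ} (hc : c ≠ 0)
    (hn : n + 1 < 2 ^ root4 n) (hw : Distorted c ε n w) (y : ℝ) :
    ∃ h : ℤ, 0 ≤ h ∧ h < 2 ^ (2 * root4 n) ∧ ∀ y' ∈ Icc (0 : ℝ) 1, |y' - y| ≤ ‖c‖ / 8 →
      ∀ u : ℝ, u = (h + y') / 2 ^ (2 * root4 n) → ∀ x : ℝ, x = (w + u) / 2 ^ n →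
        (∀ k < n + 2 * root4 n, 0 < amp c (2 ^ k • (x : Torus))) ∧
        logUp c n w - ε * n + (2 * root4 n : ℕ) * Real.log (‖c‖ / 4)
          ≤ logAmp c (n + 2 * root4 n) x ∧
        logAmp c (n + 2 * root4 n) x ≤ logUp c n w ∧
        1 / 2 ^ (2 * root4 n + 3) ≤ u ∧ u ≤ 1 - 1 / 2 ^ (2 * root4 n + 3) := by
  classical
  obtain ⟨Z, hZ, l, hlpos, hlsum, hl⟩ := hw
  have hc0 : 0 < ‖c‖ := norm_pos_iff.2 hc
  obtain ⟨h, hh0, hh1, hh⟩ := exists_connector (c := c) (r := ‖c‖ / 4) (by linarith) (root4 n)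
    (Z := insert 0 Z) (((Finset.card_insert_le _ _).trans (Nat.succ_le_succ hZ)).trans_lt hn) y
  refine ⟨h, hh0, hh1, fun y' hy' hyy u hu x hx => ?_⟩
  obtain ⟨hav, hsg⟩ := hh y' (hyy.trans_eq (by ring))
  rw [← hu] at hav hsg
  have hu01 : u ∈ Icc (0 : ℝ) 1 := by
    have h2 : (h : ℝ) ≤ 2 ^ (2 * root4 n) - 1 := by
      have := Int.le_sub_one_of_lt hh1
      exact_mod_cast this
    have h3 : (0 : ℝ) ≤ h := by exact_mod_cast hh0
    rw [hu]
    refine ⟨div_nonneg (by linarith [hy'.1]) (by positivity), ?_⟩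
    rw [div_le_one (by positivity)]
    linarith [hy'.2]
  have hxarc : (x : Torus) ∈ arc n w := ⟨u, hu01.1, hu01.2, by rw [hx]⟩
  have hxu : 2 ^ n • (x : Torus) = (u : Torus) := by
    rw [pow_nsmul_coe, hx, mul_div_cancel₀ _ (by positivity), AddCircle.coe_add, coe_int, zero_add]
  have hin : ∀ j < n, l j ≤ amp c (2 ^ (n - 1 - j) • (x : Torus)) := by
    intro j hj
    refine hl j hj _ (nsmul_sub_mem_arc hxarc hj) fun z hz => ?_
    rw [← nsmul_two_pow_add, show n - 1 - j + (j + 1) = n by omega, hxu]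
    exact hav z (Finset.mem_insert_of_mem hz)
  have hout : ∀ k < 2 * root4 n, ‖c‖ / 4 ≤ amp c (2 ^ (n + k) • (x : Torus)) := by
    intro k hk
    rw [nsmul_two_pow_add, hxu]
    linarith [hsg k hk, two_mul_norm_le_amp c (2 ^ k • (u : Torus))]
  have hposn : ∀ k < n, 0 < amp c (2 ^ k • (x : Torus)) := by
    intro k hk
    have := hin (n - 1 - k) (by omega)
    rw [show n - 1 - (n - 1 - k) = k by omega] at this
    exact (hlpos _).trans_le this
  have hsplit : logAmp c (n + 2 * root4 n) x = logAmp c n x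
      + ∑ k ∈ Finset.range (2 * root4 n), Real.log (amp c (2 ^ (n + k) • (x : Torus))) := by
    rw [logAmp, Finset.sum_range_add, logAmp]
  refine ⟨fun k hk => ?_, ?_, ?_, ?_, ?_⟩
  · rcases lt_or_ge k n with hkn | hkn
    · exact hposn k hkn
    · have := hout (k - n) (by omega)
      rw [show n + (k - n) = k by omega] at this
      linarith
  · rw [hsplit]
    have h1 : ∑ j ∈ Finset.range n, Real.log (l j) ≤ logAmp c n x := by
      rw [logAmp_eq_sum_reflect]
      exact Finset.sum_le_sum fun j hj =>
        Real.log_le_log (hlpos j) (hin j (Finset.mem_range.1 hj))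
    have h2 : ((2 * root4 n : ℕ) : ℝ) * Real.log (‖c‖ / 4)
        ≤ ∑ k ∈ Finset.range (2 * root4 n), Real.log (amp c (2 ^ (n + k) • (x : Torus))) := by
      have := Finset.card_nsmul_le_sum (Finset.range (2 * root4 n))
        (fun k => Real.log (amp c (2 ^ (n + k) • (x : Torus)))) (Real.log (‖c‖ / 4))
        fun k hk => Real.log_le_log (by linarith) (hout k (Finset.mem_range.1 hk))
      rwa [Finset.card_range, nsmul_eq_mul] at this
    linarith
  · rw [hsplit]
    have h1 := logAmp_le_logUp hxarc hposn
    have h2 : ∑ k ∈ Finset.range (2 * root4 n), Real.log (amp c (2 ^ (n + k) • (x : Torus))) ≤ 0 :=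
      Finset.sum_nonpos fun k _ => Real.log_nonpos (amp_nonneg _ _) (amp_le_one _ _)
    linarith
  · have h1 := hav 0 (Finset.mem_insert_self _ _)
    rw [sub_zero] at h1
    exact h1.trans ((norm_coe_le_abs u).trans_eq (abs_of_nonneg hu01.1))
  · have h1 := hav 0 (Finset.mem_insert_self _ _)
    have h2 : (u : Torus) = ((u - 1 : ℝ) : Torus) := by
      rw [AddCircle.coe_sub, show ((1 : ℝ) : Torus) = 0 by exact_mod_cast coe_int 1, sub_zero]
    rw [sub_zero, h2] at h1
    have h3 := h1.trans (norm_coe_le_abs (u - 1))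
    rw [abs_of_nonpos (by linarith [hu01.2])] at h3
    linarith

/-- The length of a block made of a word of length `n` and a connector. -/
def blockLen (n : ℕ) : ℕ := n + 2 * root4 n

/-- The total length of the first `j` blocks, with words of lengths `J, J + 1, …`. -/
def blockSum (J j : ℕ) : ℕ := ∑ i ∈ Finset.range j, blockLen (J + i)

lemma blockSum_succ (J j : ℕ) : blockSum J (j + 1) = blockSum J j + blockLen (J + j) :=
  Finset.sum_range_succ _ _

lemma le_blockLen (n : ℕ) : n ≤ blockLen n := Nat.le_add_right _ _

lemma blockLen_le (n : ℕ) : blockLen n ≤ 3 * n := by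
  have h : root4 n ≤ n := (Nat.sqrt_le_self _).trans (Nat.sqrt_le_self _)
  unfold blockLen
  omega

lemma mul_pred_le_two_mul_blockSum (J j : ℕ) : j * (j - 1) ≤ 2 * blockSum J j := by
  rw [← Finset.sum_range_id_mul_two, mul_comm, blockSum]
  gcongr with i hi
  exact (Nat.le_add_left i J).trans (le_blockLen _)

lemma tendsto_blockSum (J : ℕ) : Tendsto (blockSum J) atTop atTop := by
  refine tendsto_atTop.2 fun B => ?_
  filter_upwards [eventually_ge_atTop (2 * B + 2)] with j hj
  have h1 := mul_pred_le_two_mul_blockSum J j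
  have h2 : 2 * B * 1 ≤ j * (j - 1) := Nat.mul_le_mul (by omega) (by omega)
  omega

lemma eventually_blockSum_succ_le (J : ℕ) {a : ℝ} (ha : 1 < a) :
    ∀ᶠ j in atTop, (blockSum J (j + 1) : ℝ) ≤ a * blockSum J j := by
  filter_upwards [eventually_ge_atTop J, eventually_ge_atTop (⌈12 / (a - 1)⌉₊ + 1)] with j hj hj'
  have h1 : 12 / (a - 1) ≤ (j : ℝ) - 1 := by
    have h2 : ((⌈12 / (a - 1)⌉₊ + 1 : ℕ) : ℝ) ≤ j := by exact_mod_cast hj'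
    push_cast at h2
    linarith [Nat.le_ceil (12 / (a - 1))]
  rw [div_le_iff₀ (by linarith)] at h1
  have h2 : (j : ℝ) * (j - 1) ≤ 2 * blockSum J j := by
    have h3 := mul_pred_le_two_mul_blockSum J j
    rw [← Nat.cast_pred (by omega)]
    exact_mod_cast h3
  have h3 : (blockLen (J + j) : ℝ) ≤ 3 * (J + j) := by exact_mod_cast blockLen_le (J + j)
  have h4 : (J : ℝ) ≤ j := by exact_mod_cast hj
  rw [blockSum_succ]
  push_cast
  nlinarith [Nat.cast_nonneg (α := ℝ) j]

lemma logAmp_add (c : Torus) (m n : ℕ) (x : Torus) :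
    logAmp c (m + n) x = logAmp c m x + logAmp c n (2 ^ m • x) := by
  rw [logAmp, Finset.sum_range_add, logAmp, logAmp]
  simp only [nsmul_two_pow_add]

lemma antitone_logAmp (c x : Torus) : Antitone fun n => logAmp c n x :=
  antitone_nat_of_succ_le fun n => by
    rw [logAmp, Finset.sum_range_succ]
    exact add_le_of_nonpos_right (Real.log_nonpos (amp_nonneg _ _) (amp_le_one _ _))

lemma tendsto_logAmp_of_blocks {c x : Torus} {b : ℝ} {J : ℕ}
    (h : (fun j : ℕ => logAmp c (blockLen (J + j)) (2 ^ blockSum J j • x) - b * (J + j : ℕ))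
      =o[atTop] fun j : ℕ => ((J + j : ℕ) : ℝ)) :
    Tendsto (fun n : ℕ => logAmp c n x / n) atTop (𝓝 b) := by
  have hJ : Tendsto (fun j => J + j) atTop atTop := tendsto_atTop_mono (Nat.le_add_left · J) tendsto_id
  have h1 : (fun j : ℕ => logAmp c (blockLen (J + j)) (2 ^ blockSum J j • x)
      - b * blockLen (J + j)) =o[atTop] fun j : ℕ => (blockLen (J + j) : ℝ) := by
    have h2 : (fun j : ℕ => ((J + j : ℕ) : ℝ)) =O[atTop] fun j : ℕ => (blockLen (J + j) : ℝ) :=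
      Asymptotics.isBigO_of_le _ fun j => by
        rw [Real.norm_of_nonneg (by positivity), Real.norm_of_nonneg (by positivity)]
        exact_mod_cast le_blockLen _
    have h3 := ((root4_isLittleO.comp_tendsto hJ).const_mul_left (2 * b))
    refine ((h.sub h3).trans_isBigO h2).congr_left fun j => ?_
    simp only [Function.comp, blockLen]
    push_cast
    ring
  have hsum : ∀ j, ∑ i ∈ Finset.range j, (logAmp c (blockLen (J + i)) (2 ^ blockSum J i • x)
      - b * blockLen (J + i)) = logAmp c (blockSum J j) x - b * blockSum J j := by
    intro j
    induction j with
    | zero => simp [blockSum, logAmp]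
    | succ j ih =>
      rw [Finset.sum_range_succ, ih, blockSum_succ, logAmp_add]
      push_cast
      ring
  have h4 : (fun j => logAmp c (blockSum J j) x - b * blockSum J j)
      =o[atTop] fun j => (blockSum J j : ℝ) := by
    have h5 := h1.sum_range (fun j => Nat.cast_nonneg _) (by
      have := tendsto_natCast_atTop_atTop (R := ℝ).comp (tendsto_blockSum J)
      refine this.congr fun j => ?_
      simp [blockSum])
    refine (h5.congr_left hsum).congr_right fun j => ?_
    simp [blockSum]
  have h5 : Tendsto (fun j => -logAmp c (blockSum J j) x / blockSum J j) atTop (𝓝 (-b)) := by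
    have h6 := h4.tendsto_div_nhds_zero.const_sub (-b)
    rw [sub_zero] at h6
    refine h6.congr' ?_
    filter_upwards [(tendsto_blockSum J).eventually_gt_atTop 0] with j hj
    have : (blockSum J j : ℝ) ≠ 0 := by positivity
    field_simp
    ring
  have h6 := tendsto_div_of_monotone_of_exists_subseq_tendsto_div (fun n => -logAmp c n x) (-b)
    (antitone_logAmp c x).neg fun a ha =>
      ⟨blockSum J, eventually_blockSum_succ_le J ha, tendsto_blockSum J, h5⟩
  simpa [neg_div] using h6.neg

lemma exists_mem_rateSet_of_words {c : Torus} (hc : c ≠ 0) {a : ℝ} {J : ℕ} {ε : ℕ → ℝ}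
    (hε : Tendsto ε atTop (𝓝 0))
    (hJ : ∀ n, J ≤ n → n + 1 < 2 ^ root4 n ∧ 1 / 2 ^ n ≤ ‖c‖ / 8) {w : ℕ → ℤ}
    (hw0 : ∀ j, 0 ≤ w j) (hw1 : ∀ j, w j < 2 ^ (J + j))
    (hup : ∀ j, |2 * logUp c (J + j) (w j) - a * (J + j : ℕ)| ≤ ε (J + j) * (J + j : ℕ))
    (hdist : ∀ j, Distorted c (ε (J + j)) (J + j) (w j)) :
    ∃ x ∈ rateSet c (a / 2), ∃ y u : ℕ → ℝ, ∀ j, 2 ^ blockSum J j • x = (y j : Torus) ∧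
      y j = (w j + u j) / 2 ^ (J + j) ∧ 1 / 2 ^ (2 * root4 (J + j) + 3) ≤ u j ∧
        u j ≤ 1 - 1 / 2 ^ (2 * root4 (J + j) + 3) := by
  choose h hh0 hh1 hh using fun j => exists_bridge hc (hJ (J + j) (Nat.le_add_right _ _)).1
    (hdist j) (w (j + 1) / 2 ^ (J + (j + 1)))
  obtain ⟨y, hy01, hy⟩ := exists_expansion (fun j => blockLen (J + j))
    (fun j => w j * 2 ^ (2 * root4 (J + j)) + h j)
    (fun j => add_nonneg (mul_nonneg (hw0 j) (by positivity)) (hh0 j)) (fun j => by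
      have h1 : w j * 2 ^ (2 * root4 (J + j)) ≤ (2 ^ (J + j) - 1) * 2 ^ (2 * root4 (J + j)) :=
        mul_le_mul_of_nonneg_right (Int.le_sub_one_of_lt (hw1 j)) (by positivity)
      simp only [blockLen, pow_add]
      rw [pow_add] at h1
      linarith [hh1 j])
  set u : ℕ → ℝ := fun j => (h j + y (j + 1)) / 2 ^ (2 * root4 (J + j)) with hu
  have hu01 : ∀ j, u j ∈ Icc (0 : ℝ) 1 := by
    intro j
    have h2 : (h j : ℝ) ≤ 2 ^ (2 * root4 (J + j)) - 1 := by
      have := Int.le_sub_one_of_lt (hh1 j)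
      exact_mod_cast this
    have h3 : (0 : ℝ) ≤ h j := by exact_mod_cast hh0 j
    refine ⟨div_nonneg (by linarith [(hy01 (j + 1)).1]) (by positivity), ?_⟩
    simp only [hu]
    rw [div_le_one (by positivity)]
    linarith [(hy01 (j + 1)).2]
  have hyu : ∀ j, y j = (w j + u j) / 2 ^ (J + j) := by
    intro j
    rw [hy j]
    simp only [hu, blockLen]
    rw [pow_add]
    push_cast
    field_simp
    ring
  have hclose : ∀ j, |y (j + 1) - w (j + 1) / 2 ^ (J + (j + 1))| ≤ ‖c‖ / 8 := by
    intro j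
    rw [hyu (j + 1), ← sub_div, add_sub_cancel_left, abs_of_nonneg
      (div_nonneg (hu01 _).1 (by positivity))]
    refine le_trans ?_ (hJ (J + (j + 1)) (Nat.le_add_right _ _)).2
    gcongr
    exact (hu01 _).2
  have hshift : ∀ j, 2 ^ blockSum J j • (y 0 : Torus) = (y j : Torus) := by
    intro j
    induction j with
    | zero => simp [blockSum]
    | succ j ih =>
      rw [blockSum_succ, nsmul_two_pow_add, ih, pow_nsmul_coe, hy j,
        mul_div_cancel₀ _ (by positivity), AddCircle.coe_add, coe_int, zero_add]
  have hbr := fun j => hh j (y (j + 1)) (hy01 _) (hclose j) (u j) rfl (y j) (hyu j)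
  refine ⟨y 0, ⟨fun k => ?_, ?_⟩, y, u, fun j => ⟨hshift j, hyu j, (hbr j).2.2.2.1, (hbr j).2.2.2.2⟩⟩
  · have hex : ∃ j, k < blockSum J j := ((tendsto_blockSum J).eventually_gt_atTop k).exists
    classical
    obtain ⟨i, hi⟩ : ∃ i, Nat.find hex = i + 1 := Nat.exists_eq_succ_of_ne_zero fun h0 => by
      have := Nat.find_spec hex
      rw [h0] at this
      simp [blockSum] at this
    have h1 := Nat.find_spec hex
    have h2 := Nat.find_min hex (m := i) (by omega)
    rw [hi, blockSum_succ] at h1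
    have h3 := (hbr i).1 (k - blockSum J i) (by unfold blockLen at h1; omega)
    rwa [← hshift i, ← nsmul_two_pow_add, show blockSum J i + (k - blockSum J i) = k by omega] at h3
  · have hJt : Tendsto (fun j => J + j) atTop atTop :=
      tendsto_atTop_mono (Nat.le_add_left · J) tendsto_id
    refine tendsto_logAmp_of_blocks (J := J) ?_
    have hg : (fun j : ℕ => 2 * (ε (J + j) * (J + j : ℕ))
        + 2 * |Real.log (‖c‖ / 4)| * (root4 (J + j) : ℝ)) =o[atTop]
        fun j : ℕ => ((J + j : ℕ) : ℝ) := by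
      refine Asymptotics.IsLittleO.add (Asymptotics.IsLittleO.const_mul_left ?_ 2)
        ((root4_isLittleO.comp_tendsto hJt).const_mul_left _)
      have h1 := ((Asymptotics.isLittleO_one_iff ℝ).2 (hε.comp hJt)).mul_isBigO
        (Asymptotics.isBigO_refl (fun j : ℕ => ((J + j : ℕ) : ℝ)) atTop)
      simpa using h1
    refine Asymptotics.IsBigO.trans_isLittleO (Asymptotics.isBigO_of_le _ fun j => ?_) hg
    obtain ⟨-, hlo, hhi, -, -⟩ := hbr j
    have hab := abs_le.1 (hup j)
    have h4 := mul_le_mul_of_nonneg_left (neg_abs_le (Real.log (‖c‖ / 4)))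
      (Nat.cast_nonneg (α := ℝ) (2 * root4 (J + j)))
    have h5 : 0 ≤ |Real.log (‖c‖ / 4)| * (root4 (J + j) : ℝ) := by positivity
    rw [hshift j, blockLen]
    refine (?_ : _ ≤ _).trans (Real.le_norm_self _)
    rw [Real.norm_eq_abs, abs_le]
    push_cast at *
    constructor <;> nlinarith

lemma exists_tendsto_zero_of_forall_eventually {P : ℝ → ℕ → Prop}
    (h : ∀ ε > 0, ∀ᶠ n in atTop, P ε n) :
    ∃ ε : ℕ → ℝ, Tendsto ε atTop (𝓝 0) ∧ ∀ᶠ n in atTop, P (ε n) n := by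
  classical
  set Q : ℕ → ℕ → Prop := fun n k => ∀ m, n ≤ m → P (1 / ((k : ℝ) + 1)) m with hQ
  have hev : ∀ k, ∀ᶠ n in atTop, Q n k := fun k => by
    obtain ⟨N, hN⟩ := eventually_atTop.1 (h (1 / ((k : ℝ) + 1)) (by positivity))
    filter_upwards [eventually_ge_atTop N] with n hn m hm using hN m (hn.trans hm)
  have hK : Tendsto (fun n => Nat.findGreatest (Q n) n) atTop atTop := by
    refine tendsto_atTop.2 fun k => ?_
    filter_upwards [hev k, eventually_ge_atTop k] with n hn hkn using Nat.le_findGreatest hkn hn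
  refine ⟨fun n => 1 / ((Nat.findGreatest (Q n) n : ℝ) + 1),
    tendsto_one_div_add_atTop_nhds_zero_nat.comp hK, ?_⟩
  filter_upwards [hev 0] with n hn
  exact Nat.findGreatest_spec (P := Q n) (Nat.zero_le n) hn n le_rfl

lemma le_norm_sub_of_ne {n : ℕ} {w w' : ℤ} (hw0 : 0 ≤ w) (hw1 : w < 2 ^ n) (hw0' : 0 ≤ w')
    (hw1' : w' < 2 ^ n) (hne : w ≠ w') {η u u' : ℝ} (hu : η ≤ u) (hu1 : u ≤ 1 - η) (hu' : η ≤ u')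
    (hu1' : u' ≤ 1 - η) :
    η / 2 ^ n ≤ ‖(((w + u) / 2 ^ n : ℝ) : Torus) - (((w' + u') / 2 ^ n : ℝ) : Torus)‖ := by
  by_contra! hlt
  obtain ⟨s, hs, hsn⟩ := exists_lift_abs_eq_norm
    ((((w + u) / 2 ^ n : ℝ) : Torus) - (((w' + u') / 2 ^ n : ℝ) : Torus))
  rw [← hsn, lt_div_iff₀ (by positivity)] at hlt
  rw [← AddCircle.coe_sub, eq_comm, ← sub_eq_zero, ← AddCircle.coe_sub,
    AddCircle.coe_eq_zero_iff] at hs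
  obtain ⟨k, hk⟩ := hs
  rw [zsmul_eq_mul, mul_one] at hk
  have hP : (0 : ℝ) < 2 ^ n := by positivity
  have h1 : ((w - w' - k * 2 ^ n : ℤ) : ℝ) = s * 2 ^ n - (u - u') := by
    push_cast
    rw [hk]
    field_simp
    ring
  rw [show |s| * 2 ^ n = |s * 2 ^ n| by rw [abs_mul, abs_of_pos hP], abs_lt] at hlt
  have h2 : |w - w' - k * 2 ^ n| < 1 := by
    have h3 : |((w - w' - k * 2 ^ n : ℤ) : ℝ)| < 1 := by
      rw [h1, abs_lt]
      constructor <;> linarith [hlt.1, hlt.2]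
    exact_mod_cast h3
  rw [Int.abs_lt_one_iff] at h2
  have h4 : w - w' = k * 2 ^ n := by linarith
  have h5 : |k| < 1 := by
    have h6 : |k * 2 ^ n| < 1 * 2 ^ n := by
      rw [← h4, abs_lt]
      constructor <;> linarith
    rw [abs_mul, abs_of_pos (show (0 : ℤ) < 2 ^ n by positivity)] at h6
    exact lt_of_mul_lt_mul_right h6 (by positivity)
  rw [Int.abs_lt_one_iff] at h5
  rw [h5, zero_mul] at h4
  exact hne (by linarith)

lemma le_dimH_of_le_mul_norm_rpow {S : Set Torus} {φ : ℝ → Torus} {C r : NNReal} (hr : 0 < r)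
    (hφ : ∀ t ∈ Ico (0 : ℝ) 1, φ t ∈ S)
    (h : ∀ t ∈ Ico (0 : ℝ) 1, ∀ t' ∈ Ico (0 : ℝ) 1, |t - t'| ≤ C * ‖φ t - φ t'‖ ^ (r : ℝ)) :
    (r : ℝ≥0∞) ≤ dimH S := by
  have hinj : InjOn φ (Ico 0 1) := fun t ht t' ht' htt => by
    have := h t ht t' ht'
    rw [htt, sub_self, norm_zero, Real.zero_rpow (by positivity), mul_zero] at this
    exact sub_eq_zero.1 (abs_nonpos_iff.1 this)
  have hinv := hinj.leftInvOn_invFunOn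
  have hH : HolderOnWith C r (Function.invFunOn φ (Ico (0 : ℝ) 1)) (φ '' Ico 0 1) := by
    rintro _ ⟨t, ht, rfl⟩ _ ⟨t', ht', rfl⟩
    rw [hinv ht, hinv ht', edist_dist, edist_dist, Real.dist_eq, dist_eq_norm,
      ENNReal.ofReal_rpow_of_nonneg (norm_nonneg _) r.coe_nonneg, ← ENNReal.ofReal_coe_nnreal,
      ← ENNReal.ofReal_mul C.coe_nonneg]
    exact ENNReal.ofReal_le_ofReal (h t ht t' ht')
  have h1 := hH.dimH_image_le hr
  rw [hinv.image_image, Real.dimH_of_nonempty_interior (by simp)] at h1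
  rw [ENNReal.le_div_iff_mul_le (Or.inl (by simpa using hr.ne')) (Or.inl (by simp)), Module.finrank_self,
    Nat.cast_one, one_mul] at h1
  exact h1.trans (dimH_mono (image_subset_iff.2 hφ))

/-- The digits of `t` in the mixed radix expansion with radices `2 ^ κ i`. -/
def digit (κ : ℕ → ℕ) (t : ℝ) (i : ℕ) : ℕ :=
  ⌊t * 2 ^ ∑ l ∈ Finset.range (i + 1), κ l⌋₊ % 2 ^ κ i

lemma abs_sub_le_of_digit_eq (κ : ℕ → ℕ) {t t' : ℝ} (ht : t ∈ Ico (0 : ℝ) 1)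
    (ht' : t' ∈ Ico (0 : ℝ) 1) {j : ℕ} (h : ∀ i < j, digit κ t i = digit κ t' i) :
    |t - t'| ≤ 1 / 2 ^ ∑ l ∈ Finset.range j, κ l := by
  have key : ∀ s ∈ Ico (0 : ℝ) 1, ∀ i, ⌊s * 2 ^ ∑ l ∈ Finset.range (i + 1), κ l⌋₊ / 2 ^ κ i
      = ⌊s * 2 ^ ∑ l ∈ Finset.range i, κ l⌋₊ := by
    intro s _ i
    have := Nat.floor_div_natCast (s * 2 ^ ∑ l ∈ Finset.range (i + 1), κ l) (2 ^ κ i)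
    rw [← this, Finset.sum_range_succ, pow_add]
    push_cast
    rw [← mul_assoc, mul_div_cancel_right₀ _ (by positivity)]
  have hfl : ∀ i ≤ j, ⌊t * 2 ^ ∑ l ∈ Finset.range i, κ l⌋₊
      = ⌊t' * 2 ^ ∑ l ∈ Finset.range i, κ l⌋₊ := by
    intro i hi
    induction i with
    | zero => simp [Nat.floor_eq_zero.2 ht.2, Nat.floor_eq_zero.2 ht'.2]
    | succ i ih =>
      have h1 := h i (by omega)
      rw [digit, digit] at h1
      rw [← Nat.div_add_mod ⌊t * 2 ^ ∑ l ∈ Finset.range (i + 1), κ l⌋₊ (2 ^ κ i),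
        ← Nat.div_add_mod ⌊t' * 2 ^ ∑ l ∈ Finset.range (i + 1), κ l⌋₊ (2 ^ κ i), h1,
        key t ht, key t' ht', ih (by omega)]
  have hj := hfl j le_rfl
  set P : ℝ := 2 ^ ∑ l ∈ Finset.range j, κ l with hP
  have hP0 : 0 < P := by positivity
  have a1 := Nat.floor_le (mul_nonneg ht.1 hP0.le)
  have a2 := Nat.lt_floor_add_one (t * P)
  have b1 := Nat.floor_le (mul_nonneg ht'.1 hP0.le)
  have b2 := Nat.lt_floor_add_one (t' * P)
  rw [hj] at a1 a2
  rw [le_div_iff₀ hP0, show |t - t'| * P = |(t - t') * P| by rw [abs_mul, abs_of_pos hP0], abs_le]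
  constructor <;> nlinarith

lemma exists_injOn_of_two_pow_le {S : Finset ℤ} {k : ℕ} (h : 2 ^ k ≤ S.card) :
    ∃ ι : ℕ → ℤ, (∀ s < 2 ^ k, ι s ∈ S) ∧ ∀ s < 2 ^ k, ∀ s' < 2 ^ k, ι s = ι s' → s = s' := by
  refine ⟨fun s => if hs : s < S.card then (S.equivFin.symm ⟨s, hs⟩ : ℤ) else 0, fun s hs => ?_,
    fun s hs s' hs' hss => ?_⟩
  · simp only [dif_pos (hs.trans_le h)]
    exact Subtype.property _
  · simp only [dif_pos (hs.trans_le h), dif_pos (hs'.trans_le h)] at hss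
    simpa using S.equivFin.symm.injective (Subtype.ext hss)

lemma eventually_mul_blockLen_succ_le {r' r : ℝ} (hr0 : 0 < r') (hrr : r' < r) :
    ∀ᶠ n : ℕ in atTop, r' * blockLen (n + 1) ≤ r * n - 1 := by
  have h1 := (root4_isLittleO.const_mul_left (2 * r')).def (c := (r - r') / 2) (by linarith)
  filter_upwards [(tendsto_add_atTop_nat 1).eventually h1,
    (tendsto_natCast_atTop_atTop (R := ℝ)).eventually_ge_atTop ((2 + r + r') / (r - r'))] with n h2 h3
  rw [Real.norm_of_nonneg (by positivity), Real.norm_of_nonneg (by positivity)] at h2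
  rw [div_le_iff₀ (by linarith)] at h3
  unfold blockLen
  push_cast at *
  nlinarith

lemma le_dimH_rateSet {c : Torus} (hc : c ≠ 0) {a : ℝ} {r' r : NNReal} (hr0 : 0 < r')
    (hrr : r' < r) {ε : ℕ → ℝ} (hε : Tendsto ε atTop (𝓝 0))
    (h : ∀ᶠ n : ℕ in atTop, ∃ S : Finset ℤ, (2 : ℝ) ^ ((r : ℝ) * n) ≤ S.card ∧ ∀ i ∈ S,
      0 ≤ i ∧ i < 2 ^ n ∧ |2 * logUp c n i - a * n| ≤ ε n * n ∧ Distorted c (ε n) n i) :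
    (r' : ℝ≥0∞) ≤ dimH (rateSet c (a / 2)) := by
  have hr0' : (0 : ℝ) < r' := hr0
  have hrr' : (r' : ℝ) < r := hrr
  have hc0 : 0 < ‖c‖ := norm_pos_iff.2 hc
  have hsmall : ∀ᶠ n : ℕ in atTop, (1 : ℝ) / 2 ^ n ≤ ‖c‖ / 8 := by
    have h1 := tendsto_pow_atTop_nhds_zero_of_lt_one (r := (1 / 2 : ℝ)) (by norm_num) (by norm_num)
    filter_upwards [h1.eventually_le_const (show (0 : ℝ) < ‖c‖ / 8 by positivity)] with n hn
    rwa [one_div_pow] at hn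
  have hcodes : ∀ᶠ n : ℕ in atTop, ∃ ι : ℕ → ℤ, (∀ s < 2 ^ ⌊(r : ℝ) * n⌋₊,
      0 ≤ ι s ∧ ι s < 2 ^ n ∧ |2 * logUp c n (ι s) - a * n| ≤ ε n * n ∧ Distorted c (ε n) n (ι s)) ∧
      ∀ s < 2 ^ ⌊(r : ℝ) * n⌋₊, ∀ s' < 2 ^ ⌊(r : ℝ) * n⌋₊, ι s = ι s' → s = s' := by
    filter_upwards [h] with n hn
    obtain ⟨S, hS, hSi⟩ := hn
    have hk : 2 ^ ⌊(r : ℝ) * n⌋₊ ≤ S.card := by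
      have h1 : (2 : ℝ) ^ (⌊(r : ℝ) * n⌋₊ : ℝ) ≤ 2 ^ ((r : ℝ) * n) :=
        Real.rpow_le_rpow_of_exponent_le (by norm_num) (Nat.floor_le (by positivity))
      rw [Real.rpow_natCast] at h1
      exact_mod_cast h1.trans hS
    obtain ⟨ι, hι, hinj⟩ := exists_injOn_of_two_pow_le hk
    exact ⟨ι, fun s hs => hSi _ (hι s hs), hinj⟩
  obtain ⟨J, hJ⟩ := eventually_atTop.1 (eventually_succ_lt_two_pow_root4.and (hsmall.and
    ((eventually_mul_blockLen_succ_le hr0' hrr').and hcodes)))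
  choose ι hι hinj using fun j => (hJ (J + j) (Nat.le_add_right _ _)).2.2.2
  set κ : ℕ → ℕ := fun j => ⌊(r : ℝ) * (J + j : ℕ)⌋₊ with hκ
  have hdig : ∀ t j, digit κ t j < 2 ^ κ j := fun t j => Nat.mod_lt _ (by positivity)
  choose φ hφ y u hyu using fun t : ℝ => exists_mem_rateSet_of_words hc hε
    (fun n hn => ⟨(hJ n hn).1, (hJ n hn).2.1⟩) (w := fun j => ι j (digit κ t j))
    (fun j => (hι j _ (hdig t j)).1) (fun j => (hι j _ (hdig t j)).2.1)
    (fun j => (hι j _ (hdig t j)).2.2.1) (fun j => (hι j _ (hdig t j)).2.2.2)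
  have hM : ∀ j, (r' : ℝ) * blockSum J (j + 1) - r' * blockLen J
      ≤ (∑ l ∈ Finset.range j, κ l : ℕ) := by
    intro j
    induction j with
    | zero => simp [blockSum]
    | succ j ih =>
      have h1 := (hJ (J + j) (Nat.le_add_right _ _)).2.2.1
      have h2 := Nat.lt_floor_add_one ((r : ℝ) * (J + j : ℕ))
      have h3 : (κ j : ℝ) = ⌊(r : ℝ) * (J + j : ℕ)⌋₊ := rfl
      rw [blockSum_succ, Finset.sum_range_succ, show J + (j + 1) = J + j + 1 by ring]
      push_cast at *
      linarith
  have hκpos : ∀ j, 1 ≤ κ j := by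
    intro j
    have h1 := (hJ (J + j) (Nat.le_add_right _ _)).2.2.1
    refine Nat.le_floor ?_
    have h2 : 0 ≤ (r' : ℝ) * blockLen (J + j + 1) := by positivity
    push_cast at *
    linarith
  refine le_dimH_of_le_mul_norm_rpow (φ := φ) (C := 2 ^ ((r' : ℝ) * (blockLen J + 3))) hr0
    (fun t _ => hφ t) fun t ht t' ht' => ?_
  by_cases hall : ∀ i, digit κ t i = digit κ t' i
  · have hz : |t - t'| ≤ 0 := by
      refine ge_of_tendsto' (tendsto_pow_atTop_nhds_zero_of_lt_one (r := (1 / 2 : ℝ))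
        (by norm_num) (by norm_num)) fun j => ?_
      refine (abs_sub_le_of_digit_eq κ ht ht' (j := j) fun i _ => hall i).trans ?_
      rw [one_div_pow]
      gcongr
      · norm_num
      · simpa using Finset.card_nsmul_le_sum (Finset.range j) κ 1 fun i _ => hκpos i
    exact hz.trans (by positivity)
  · push Not at hall
    classical
    have hj := Nat.find_spec hall
    have hlt := fun i hi => not_not.1 (Nat.find_min hall (m := i) hi)
    set j := Nat.find hall
    refine (abs_sub_le_of_digit_eq κ ht ht' hlt).trans ?_
    obtain ⟨e1, e2, e3, e4⟩ := hyu t j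
    obtain ⟨f1, f2, f3, f4⟩ := hyu t' j
    have h1 := le_norm_sub_of_ne (hι j _ (hdig t j)).1 (hι j _ (hdig t j)).2.1
      (hι j _ (hdig t' j)).1 (hι j _ (hdig t' j)).2.1
      (fun hw => hj (hinj j _ (hdig t j) _ (hdig t' j) hw)) e3 e4 f3 f4
    rw [← e2, ← f2, ← e1, ← f1, ← smul_sub] at h1
    have h2 : 1 / 2 ^ (blockSum J (j + 1) + 3) ≤ ‖φ t - φ t'‖ := by
      have h3 := h1.trans (norm_pow_two_nsmul_le _ _)
      rw [← div_le_iff₀' (by positivity)] at h3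
      refine le_of_eq_of_le ?_ h3
      rw [blockSum_succ, blockLen, div_div, div_div, ← pow_add, ← pow_add]
      congr 2
      ring
    have h4 : (2 : ℝ) ^ (-(((blockSum J (j + 1) + 3 : ℕ) : ℝ) * r')) ≤ ‖φ t - φ t'‖ ^ (r' : ℝ) := by
      rw [← neg_mul, Real.rpow_mul (by norm_num), Real.rpow_neg (by norm_num), Real.rpow_natCast,
        ← one_div]
      exact Real.rpow_le_rpow (by positivity) h2 hr0'.le
    rw [NNReal.coe_rpow]
    refine le_trans ?_ (mul_le_mul_of_nonneg_left h4 (by positivity))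
    rw [NNReal.coe_ofNat, ← Real.rpow_add (by norm_num), ← Real.rpow_natCast, one_div,
      ← Real.rpow_neg (by norm_num)]
    refine Real.rpow_le_rpow_of_exponent_le (by norm_num) ?_
    have := hM j
    push_cast at *
    linarith

lemma IsGMeasure.dimH_le_rateSet {c : Torus} (hc : c ≠ 0) {μ : Measure Torus}
    (hμ : IsGMeasure c μ) (h0 : μ {0} = 0) (hpos : ∀ (n : ℕ) (ω : Fin n → Bool), 0 < μ (cyl n ω))
    (α : ℝ) : dimH {x | HasLocDim μ x α} ≤ dimH (rateSet c (-α * Real.log 2 / 2)) := by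
  refine le_of_forall_lt fun d hd => ?_
  obtain ⟨r', hdr', hr'⟩ := ENNReal.lt_iff_exists_nnreal_btwn.1 hd
  obtain ⟨r, hr'r, hr⟩ := ENNReal.lt_iff_exists_nnreal_btwn.1 hr'
  refine hdr'.trans_le ?_
  set a := -α * Real.log 2
  have hP : ∀ ε > 0, ∀ᶠ n : ℕ in atTop, ∃ S : Finset ℤ, (2 : ℝ) ^ ((r : ℝ) * n) ≤ S.card ∧
      ∀ i ∈ S, 0 ≤ i ∧ i < 2 ^ n ∧ |2 * logUp c n i - a * n| ≤ ε * n ∧ Distorted c ε n i := by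
    intro ε hε
    have h1 : ∀ᶠ n : ℕ in atTop, (2 : ℝ) ^ ((r : ℝ) * n) < (typicalArcs c a ε n).card := by
      by_contra hcon
      rw [not_eventually] at hcon
      exact hr.not_ge (hμ.dimH_le_of_frequently hc h0 hpos hε (hcon.mono fun n hn => not_lt.1 hn))
    filter_upwards [h1, eventually_distorted c (A := (|a| + ε) / 2) (by positivity) hε] with n hn hd
    refine ⟨typicalArcs c a ε n, hn.le, fun i hi => ?_⟩
    simp only [typicalArcs, Finset.mem_filter, Finset.mem_Ico] at hi
    refine ⟨hi.1.1, hi.1.2, hi.2, hd i ?_⟩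
    have h2 := (abs_le.1 hi.2).1
    nlinarith [mul_le_mul_of_nonneg_right (neg_abs_le a) (Nat.cast_nonneg (α := ℝ) n)]
  obtain ⟨ε, hε, h⟩ := exists_tendsto_zero_of_forall_eventually hP
  exact le_dimH_rateSet hc (by simpa using zero_le.trans_lt hdr') (by exact_mod_cast hr'r) hε h

/-- for `c ≠ 0`, a non-atomic fully supported `g`-measure `μ` for `g^c`, and
any `α ≠ −α̲_c / log 2`, the level set of points of local dimension `α` of `μ` and the
level set of points with Birkhoff average `ψ̄^c = −α log 2` have the same Hausdorff
dimension. -/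
theorem stmt5 (c : Torus) (hc : c ≠ 0) (μ : Measure Torus) (hμ : IsGMeasure c μ)
    (hna : ∀ x : Torus, μ {x} = 0)
    (hpos : ∀ (n : ℕ) (ω : Fin n → Bool), 0 < μ (cyl n ω))
    (α : ℝ) (hα : ((-α * Real.log 2 : ℝ) : EReal) ≠ alphaLower c) :
    dimH {x : Torus | HasLocDim μ x α} =
      dimH {x : Torus |
        Tendsto (fun n : ℕ => (((n : ℝ)⁻¹ : ℝ) : EReal) * psiSum c n x) atTop
          (𝓝 ((-α * Real.log 2 : ℝ) : EReal))} := by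
  refine (?_ : _ = dimH (rateSet c (-α * Real.log 2 / 2))).trans
    (congrArg dimH (Set.ext fun x => (tendsto_psiSum_iff c x _).symm))
  exact le_antisymm (hμ.dimH_le_rateSet hc (hna 0) hpos α)
    (dimH_mono fun x hx => hμ.hasLocDim_of_mem_rateSet hc (hna 0) hpos hx)

end GTM
end
end

section
/- Let c ∈ ℝ, φ = e^{2πi c}, and t_n = e^{2πi c·S₂(n)} for n ∈ ℕ₀, where S₂(n) is the number of ones in the binary expansion of n (the generalized Thue–Morse sequence). Suppose that for every n ∈ ℕ₀ the limit η_n := lim_{k→∞} (1/k)·Σ_{m=0}^{k−1} conj(t_m)·t_{m+n} exists in ℂ. Then η_0 = 1, η_1 = φ/(2 − conj(φ)), and for every n ≥ 0: η_{2n} = η_n and η_{2n+1} = (φ·η_n + conj(φ)·η_{n+1})/2. -/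
open Filter Topology ComplexConjugate

noncomputable section

namespace GTM

/-- `S₂ n` is the sum of binary digits of `n`. -/
def S2 (n : ℕ) : ℕ := (Nat.digits 2 n).sum

/-- `φ_c = e^{2πi c}`. -/
def phi (c : ℝ) : ℂ := Complex.exp (2 * Real.pi * Complex.I * c)

/-- The generalized Thue–Morse sequence `t_n = e^{2πi c S₂(n)}`. -/
def tm (c : ℝ) (n : ℕ) : ℂ := Complex.exp (2 * Real.pi * Complex.I * c * S2 n)

/-- `η : ℕ → ℂ` satisfies the Thue–Morse autocorrelation recursion for parameter `c`. -/
def TMRec (c : ℝ) (η : ℕ → ℂ) : Prop :=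
  η 0 = 1 ∧
    ∀ n : ℕ, η (2 * n) = η n ∧
      η (2 * n + 1) = (phi c * η n + conj (phi c) * η (n + 1)) / 2

/-- The matrix `M_c`. -/
def Mmat (c : ℝ) : Matrix (Fin 3) (Fin 3) ℂ :=
  (1 / 2 : ℂ) •
    !![3, 1, 1;
       phi c, 2 * phi c, 0;
       conj (phi c), 0, 2 * conj (phi c)]

lemma S2_two_mul (n : ℕ) : S2 (2 * n) = S2 n := by
  rcases Nat.eq_zero_or_pos n with rfl | hn
  · simp
  · rw [S2, Nat.digits_def' one_lt_two (by omega)]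
    simp [S2]

lemma S2_two_mul_add_one (n : ℕ) : S2 (2 * n + 1) = S2 n + 1 := by
  rw [S2, Nat.digits_def' one_lt_two (by omega), show (2 * n + 1) % 2 = 1 by omega,
    show (2 * n + 1) / 2 = n by omega, List.sum_cons, S2, add_comm]

lemma tm_two_mul (c : ℝ) (n : ℕ) : tm c (2 * n) = tm c n := by
  rw [tm, tm, S2_two_mul]

lemma tm_two_mul_add_one (c : ℝ) (n : ℕ) : tm c (2 * n + 1) = phi c * tm c n := by
  rw [tm, tm, phi, S2_two_mul_add_one, ← Complex.exp_add]
  push_cast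
  ring_nf

lemma norm_phi (c : ℝ) : ‖phi c‖ = 1 := by
  rw [phi, show (2 * Real.pi * Complex.I * c : ℂ) = ((2 * Real.pi * c : ℝ) : ℂ) * Complex.I by
    push_cast; ring]
  exact Complex.norm_exp_ofReal_mul_I _

lemma norm_tm (c : ℝ) (n : ℕ) : ‖tm c n‖ = 1 := by
  rw [tm, show (2 * Real.pi * Complex.I * c * S2 n : ℂ)
    = ((2 * Real.pi * c * S2 n : ℝ) : ℂ) * Complex.I by push_cast; ring]
  exact Complex.norm_exp_ofReal_mul_I _

lemma conj_mul_self_of_norm_eq_one {z : ℂ} (hz : ‖z‖ = 1) : conj z * z = 1 := by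
  rw [Complex.conj_mul', hz]
  simp

lemma sum_range_two_mul_eq {g h : ℕ → ℂ} (hgh : ∀ m, g (2 * m) + g (2 * m + 1) = h m) (k : ℕ) :
    ∑ m ∈ Finset.range (2 * k), g m = ∑ m ∈ Finset.range k, h m := by
  induction k with
  | zero => simp
  | succ k ih =>
    rw [show 2 * (k + 1) = 2 * k + 1 + 1 by ring, Finset.sum_range_succ, Finset.sum_range_succ,
      Finset.sum_range_succ, ih, ← hgh k, add_assoc]

/-- The mean of a sequence is half the mean of the sequence of sums of its consecutive pairs. -/
lemma mean_eq_half_of_pair_sum {g h : ℕ → ℂ} {a b : ℂ}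
    (hgh : ∀ m, g (2 * m) + g (2 * m + 1) = h m)
    (hg : Tendsto (fun k : ℕ => (k : ℂ)⁻¹ * ∑ m ∈ Finset.range k, g m) atTop (𝓝 a))
    (hh : Tendsto (fun k : ℕ => (k : ℂ)⁻¹ * ∑ m ∈ Finset.range k, h m) atTop (𝓝 b)) :
    a = b / 2 := by
  have hg' := hg.comp (tendsto_id.const_mul_atTop' (two_pos : (0 : ℕ) < 2))
  refine tendsto_nhds_unique hg' ((hh.div_const 2).congr fun k => ?_)
  simp only [Function.comp_apply, id_eq, sum_range_two_mul_eq hgh]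
  push_cast
  rw [mul_inv]
  ring

/-- if all autocorrelation coefficients `η_n` of the generalized Thue–Morse
sequence exist as limits, then `η₀ = 1`, `η₁ = φ/(2 − conj φ)`, and the recursions
`η_{2n} = η_n`, `η_{2n+1} = (φ η_n + conj φ η_{n+1})/2` hold. -/
theorem stmt6 (c : ℝ) (η : ℕ → ℂ)
    (hη : ∀ n : ℕ,
      Tendsto (fun k : ℕ => (k : ℂ)⁻¹ * ∑ m ∈ Finset.range k, conj (tm c m) * tm c (m + n))
        atTop (𝓝 (η n))) :
    η 0 = 1 ∧ η 1 = phi c / (2 - conj (phi c)) ∧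
      ∀ n : ℕ, η (2 * n) = η n ∧
        η (2 * n + 1) = (phi c * η n + conj (phi c) * η (n + 1)) / 2 := by
  have hφ := conj_mul_self_of_norm_eq_one (norm_phi c)
  have h_even (n : ℕ) : η (2 * n) = η n := by
    have hpair (m : ℕ) : conj (tm c (2 * m)) * tm c (2 * m + 2 * n)
        + conj (tm c (2 * m + 1)) * tm c (2 * m + 1 + 2 * n)
        = 2 * (conj (tm c m) * tm c (m + n)) := by
      rw [show 2 * m + 1 + 2 * n = 2 * (m + n) + 1 by ring, ← mul_add 2 m n]
      simp only [tm_two_mul, tm_two_mul_add_one, map_mul]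
      linear_combination (conj (tm c m) * tm c (m + n)) * hφ
    have hlim := ((hη n).const_mul 2).congr fun k => by rw [mul_left_comm, Finset.mul_sum]
    rw [mean_eq_half_of_pair_sum hpair (hη (2 * n)) hlim]
    ring
  have h_odd (n : ℕ) : η (2 * n + 1) = (phi c * η n + conj (phi c) * η (n + 1)) / 2 := by
    have hpair (m : ℕ) : conj (tm c (2 * m)) * tm c (2 * m + (2 * n + 1))
        + conj (tm c (2 * m + 1)) * tm c (2 * m + 1 + (2 * n + 1))
        = phi c * (conj (tm c m) * tm c (m + n))
          + conj (phi c) * (conj (tm c m) * tm c (m + (n + 1))) := by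
      rw [show 2 * m + (2 * n + 1) = 2 * (m + n) + 1 by ring,
        show 2 * m + 1 + (2 * n + 1) = 2 * (m + (n + 1)) by ring]
      simp only [tm_two_mul, tm_two_mul_add_one, map_mul]
      ring
    refine mean_eq_half_of_pair_sum hpair (hη (2 * n + 1))
      ((((hη n).const_mul (phi c)).add ((hη (n + 1)).const_mul (conj (phi c)))).congr fun k => ?_)
    rw [Finset.sum_add_distrib, ← Finset.mul_sum, ← Finset.mul_sum]
    ring
  have h_zero : η 0 = 1 := by
    refine tendsto_nhds_unique (hη 0) (tendsto_const_nhds.congr' ?_)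
    filter_upwards [eventually_ne_atTop 0] with k hk
    simp [conj_mul_self_of_norm_eq_one (norm_tm c _), hk]
  refine ⟨h_zero, ?_, fun n => ⟨h_even n, h_odd n⟩⟩
  have hne : 2 - conj (phi c) ≠ 0 := by
    intro h
    have hnorm := congrArg norm (sub_eq_zero.mp h)
    rw [Complex.norm_conj, norm_phi] at hnorm
    norm_num at hnorm
  have h_one := h_odd 0
  norm_num [h_zero] at h_one
  rw [eq_div_iff hne]
  linear_combination 2 * h_one

end GTM
end
end
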